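/- Fix τ > 0, M > 2ζ(1+τ), ρ > 0, and let 0 < r' < r. For every φ = Σ_{k∈ℤ} φ̂_k e_k ∈ C_r, the formulas (Γφ)(q) = Σ_{k≠0} (1/(q^k−1)) φ̂_k(q) e_k and (Γ⁻φ)(q) = −Σ_{k≠0} (1/(q^{−k}−1)) φ̂_k(q) e_k define functions Γφ ∈ C⁺_{r'} and Γ⁻φ ∈ C⁻_{r'} satisfying: ∇(Γφ) = ∇⁻(Γ⁻φ) = φ − φ̂₀ in C_{r'}; (Γφ)⁺ = Γ⁻φ and (Γ⁻φ)⁻ = Γφ; and there is a constant C₁ > 0 depending only on τ such that, if r−r' ≤ 1, then ‖Γφ‖⁺_{r'} ≤ C₁M²(r−r')^{−σ}‖φ‖_r, ‖Γ⁻φ‖⁻_{r'} ≤ C₁M²(r−r')^{−σ}‖φ‖_r, ‖∂_θΓφ‖⁺_{r'} ≤ C₁M²(r−r')^{−σ−1}‖φ‖_r and ‖∂_θΓ⁻φ‖⁻_{r'} ≤ C₁M²(r−r')^{−σ−1}‖φ‖_r, where σ := 4+2τ. -/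

import Mathlib

open Complex Metric Set OnePoint

noncomputable section

/-- Real Riemann zeta value `ζ(s) = Σ_{m≥1} m^{-s}` for real `s`. -/
def zetaR (s : ℝ) : ℝ := ∑' n : ℕ, 1 / (n + 1 : ℝ) ^ s

/-- The set `A_M^ℝ` of real `(2+τ)`-Diophantine numbers with constant `M`. -/
def AMR (τ M : ℝ) : Set ℝ :=
  {ω | ∀ n : ℤ, ∀ m : ℕ, 0 < m → 1 / (M * (m : ℝ) ^ (2 + τ)) ≤ |ω - n / m|}

/-- The complex extension `A_M^ℂ`. -/
def AMC (τ M : ℝ) : Set ℂ :=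
  {ω | ∃ ω₀ ∈ AMR τ M, |ω₀ - ω.re| ≤ |ω.im|}

/-- `E(ω) = e^{2πiω}`. -/
def Efn (ω : ℂ) : ℂ := Complex.exp (2 * Real.pi * Complex.I * ω)

/-- The compact set `K_M = E(A_M^ℂ) ∪ {0,∞}` in the Riemann sphere `Ĉ = ℂ ∪ {∞}`. -/
def KM (τ M : ℝ) : Set (OnePoint ℂ) :=
  (fun ω => ((Efn ω : ℂ) : OnePoint ℂ)) '' AMC τ M ∪ {((0 : ℂ) : OnePoint ℂ), ∞}

/-- The chart `ξ ↦ 1/ξ` of the Riemann sphere at `∞`. -/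
def sphChart (ξ : ℂ) : OnePoint ℂ := if ξ = 0 then ∞ else ((ξ⁻¹ : ℂ) : OnePoint ℂ)

/-- `K ∩ ℂ`, in the coordinate `q`. -/
def finPart (K : Set (OnePoint ℂ)) : Set ℂ := {q : ℂ | (q : OnePoint ℂ) ∈ K}
/-- `K̃ = {ξ : 1/ξ ∈ K}`, the set `K` read in the coordinate `ξ = 1/q`. -/
def infPart (K : Set (OnePoint ℂ)) : Set ℂ := {ξ : ℂ | sphChart ξ ∈ K}

variable {α : Type*} {B : Type*} [NormedAddCommGroup B] [NormedSpace ℂ B]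

/-- Difference quotient error `Ω_{u,g}(q,q') = (u(q')−u(q))/(q'−q) − g(q)`,
for functions with values in a space of functions on `α`. -/
def omegaF (u g : ℂ → α → B) (p : ℂ × ℂ) (a : α) : B :=
  if p.1 = p.2 then 0 else (p.2 - p.1)⁻¹ • (u p.2 a - u p.1 a) - g p.1 a

/-- Continuity on `K` for the sup-norm over `S` of the values. -/
def ContSup (K : Set ℂ) (S : Set α) (u : ℂ → α → B) : Prop :=
  ∀ q ∈ K, ∀ ε > (0 : ℝ), ∃ δ > (0 : ℝ), ∀ q' ∈ K, dist q' q < δ →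
    ∀ a ∈ S, ‖u q' a - u q a‖ ≤ ε

/-- Continuity on `K × K` for the sup-norm over `S` of the values. -/
def ContSup2 (K : Set ℂ) (S : Set α) (F : ℂ × ℂ → α → B) : Prop :=
  ∀ p ∈ K ×ˢ K, ∀ ε > (0 : ℝ), ∃ δ > (0 : ℝ), ∀ p' ∈ K ×ˢ K, dist p' p < δ →
    ∀ a ∈ S, ‖F p' a - F p a‖ ≤ ε

/-- `u` is `C¹`-holomorphic on `K ⊂ ℂ` with derivative `g`, with values in the
space of bounded functions on `S` (sup norm). -/
def FPair (K : Set ℂ) (S : Set α) (u g : ℂ → α → B) : Prop :=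
  ContSup K S u ∧ ContSup K S g ∧ ContSup2 K S (omegaF u g)

def fn0 (K : Set ℂ) (S : Set α) (u : ℂ → α → B) : ℝ :=
  sSup {x : ℝ | ∃ q ∈ K, ∃ a ∈ S, x = ‖u q a‖}
def fdel (K : Set ℂ) (S : Set α) (u : ℂ → α → B) : ℝ :=
  sSup {x : ℝ | ∃ p ∈ K ×ˢ K, ∃ a ∈ S, x = ‖u (Prod.snd p) a - u (Prod.fst p) a‖}
def fn2 (K : Set ℂ) (S : Set α) (u g : ℂ → α → B) : ℝ :=
  sSup {x : ℝ | ∃ p ∈ K ×ˢ K, ∃ a ∈ S, x = ‖omegaF u g p a‖}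

/-- The `C¹_hol` norm `n₀ + max(sup‖φ'‖, sup‖δφ‖) + n₂` (one chart). -/
def fNorm (K : Set ℂ) (S : Set α) (u g : ℂ → α → B) : ℝ :=
  fn0 K S u + max (fn0 K S g) (fdel K S u) + fn2 K S u g

def FBdd (K : Set ℂ) (S : Set α) (u g : ℂ → α → B) : Prop :=
  BddAbove {x : ℝ | ∃ q ∈ K, ∃ a ∈ S, x = ‖u q a‖} ∧
    BddAbove {x : ℝ | ∃ q ∈ K, ∃ a ∈ S, x = ‖g q a‖} ∧
    BddAbove {x : ℝ | ∃ p ∈ K ×ˢ K, ∃ a ∈ S, x = ‖omegaF u g p a‖}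

/-- `C¹`-holomorphy on a subset `K` of the Riemann sphere: `C¹`-holomorphy in
both charts `q` and `ξ = 1/q`, with chartwise derivatives `g` and `h`. -/
def SPair (K : Set (OnePoint ℂ)) (S : Set α) (u : OnePoint ℂ → α → B)
    (g h : ℂ → α → B) : Prop :=
  FPair (finPart K) S (fun q : ℂ => u (q : OnePoint ℂ)) g ∧
    FPair (infPart K) S (fun ξ : ℂ => u (sphChart ξ)) h

def SBdd (K : Set (OnePoint ℂ)) (S : Set α) (u : OnePoint ℂ → α → B)
    (g h : ℂ → α → B) : Prop :=
  FBdd (finPart K) S (fun q : ℂ => u (q : OnePoint ℂ)) g ∧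
    FBdd (infPart K) S (fun ξ : ℂ => u (sphChart ξ)) h

/-- The `C¹_hol(K,·)` norm for `K ⊂ Ĉ`: max of the norms in the two charts. -/
def sNorm (K : Set (OnePoint ℂ)) (S : Set α) (u : OnePoint ℂ → α → B)
    (g h : ℂ → α → B) : ℝ :=
  max (fNorm (finPart K) S (fun q : ℂ => u (q : OnePoint ℂ)) g)
    (fNorm (infPart K) S (fun ξ : ℂ => u (sphChart ξ)) h)

/-- The strip `S_r` (identified with `{x ∈ ℂ/ℤ : |Im x| < r}` via 1-periodicity). -/
def Strip (r : ℝ) : Set ℂ := {z : ℂ | |z.im| < r}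

/-- `S_r × D_ρ`, the domain of the elements of `B_{r,ρ} = H^∞(S_r × D_ρ)`. -/
def SD (r ρ : ℝ) : Set (ℂ × ℂ) := Strip r ×ˢ Metric.ball (0 : ℂ) ρ

/-- Membership of a value in `B_{r,ρ} = H^∞(S_r × D_ρ) = H^∞(S_r, B_ρ)`:
1-periodicity in `θ` and holomorphy on `S_r × D_ρ` (boundedness being part of
the `C¹_hol` data). -/
def ValHol (r ρ : ℝ) (v : ℂ × ℂ → ℂ) : Prop :=
  (∀ θ ε : ℂ, v (θ + 1, ε) = v (θ, ε)) ∧ DifferentiableOn ℂ v (SD r ρ)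

/-- `u ∈ C_r = C¹_hol(K_M, H^∞(S_r, B_ρ))`, with chartwise derivative data `g, h`. -/
def MemC (τ M r ρ : ℝ) (u : OnePoint ℂ → ℂ × ℂ → ℂ) (g h : ℂ → ℂ × ℂ → ℂ) : Prop :=
  SPair (KM τ M) (SD r ρ) u g h ∧ SBdd (KM τ M) (SD r ρ) u g h ∧
    ∀ q ∈ KM τ M, ValHol r ρ (u q)

/-- The norm `‖u‖_r` of `u ∈ C_r`, given its derivative data `g, h`. -/
def CNorm (τ M r ρ : ℝ) (u : OnePoint ℂ → ℂ × ℂ → ℂ) (g h : ℂ → ℂ × ℂ → ℂ) : ℝ :=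
  sNorm (KM τ M) (SD r ρ) u g h

/-- The `k`-th Fourier coefficient `φ̂_k(q) ∈ B_ρ` of `u(q) ∈ H^∞(S_r, B_ρ)`. -/
def fhat (u : OnePoint ℂ → ℂ × ℂ → ℂ) (k : ℤ) (q : OnePoint ℂ) (ε : ℂ) : ℂ :=
  ∫ t in (0:ℝ)..1, u q ((t : ℂ), ε) * Complex.exp (-(2 * Real.pi * Complex.I * k * t))

/-- `e_k(θ) = e^{2πikθ}`. -/
def ek (k : ℤ) (θ : ℂ) : ℂ := Complex.exp (2 * Real.pi * Complex.I * k * θ)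

/-- `up = u⁺`, i.e. `up(q,θ) = Σ_k q^k û_k(q) e_k(θ)` on `K_M` (for `q = e^{2πiω}`
this is `u(q, θ+ω)`). -/
def IsPlus (τ M r ρ : ℝ) (u up : OnePoint ℂ → ℂ × ℂ → ℂ) : Prop :=
  ∀ q : ℂ, (q : OnePoint ℂ) ∈ KM τ M → q ≠ 0 → ∀ θ ∈ Strip r,
    ∀ ε ∈ Metric.ball (0 : ℂ) ρ,
      HasSum (fun k : ℤ => q ^ k * fhat u k (q : OnePoint ℂ) ε * ek k θ)
        (up (q : OnePoint ℂ) (θ, ε))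

/-- `um = u⁻`, i.e. `um(q,θ) = Σ_k q^{-k} û_k(q) e_k(θ)`. -/
def IsMinus (τ M r ρ : ℝ) (u um : OnePoint ℂ → ℂ × ℂ → ℂ) : Prop :=
  ∀ q : ℂ, (q : OnePoint ℂ) ∈ KM τ M → q ≠ 0 → ∀ θ ∈ Strip r,
    ∀ ε ∈ Metric.ball (0 : ℂ) ρ,
      HasSum (fun k : ℤ => q ^ (-k) * fhat u k (q : OnePoint ℂ) ε * ek k θ)
        (um (q : OnePoint ℂ) (θ, ε))

/-- The derivative `∂_θ` acting on values. -/
def dth (v : OnePoint ℂ → ℂ × ℂ → ℂ) (q : OnePoint ℂ) (p : ℂ × ℂ) : ℂ :=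
  deriv (fun t => v q (t, p.2)) p.1

/-- Real-symmetry (`u ∈ C_{r,ℝ}`): `conj(û_k(q)) = û_{-k}(1/q̄)` where
`(conj ψ)(ε) = conj(ψ(ε̄))` in `B_ρ`. -/
def RealSym (τ M : ℝ) (u : OnePoint ℂ → ℂ × ℂ → ℂ) : Prop :=
  ∀ k : ℤ, ∀ q : ℂ, (q : OnePoint ℂ) ∈ KM τ M → q ≠ 0 → ∀ ε : ℂ,
    starRingEnd ℂ (fhat u k (q : OnePoint ℂ) (starRingEnd ℂ ε)) =
      fhat u (-k) (((((starRingEnd ℂ) q)⁻¹ : ℂ) : OnePoint ℂ)) ε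

/-- The function `λ_k(q) = 1/(q^k−1)`, extended continuously to `q = 0` and `q = ∞`. -/
def lamk (k : ℤ) (q : OnePoint ℂ) : ℂ :=
  Option.elim (show Option ℂ from q) (if 0 < k then 0 else -1)
    (fun z => if z = 0 then (if 0 < k then -1 else 0) else (z ^ k - 1)⁻¹)

/-- `Γφ = Σ_{k≠0} λ_k(q) φ̂_k(q) e_k`. -/
def GamFn (u : OnePoint ℂ → ℂ × ℂ → ℂ) (q : OnePoint ℂ) (p : ℂ × ℂ) : ℂ :=
  ∑' k : ℤ, if k = 0 then 0 else lamk k q * fhat u k q p.2 * ek k p.1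

/-- `Γ⁻φ = −Σ_{k≠0} λ_{−k}(q) φ̂_k(q) e_k`. -/
def GamMFn (u : OnePoint ℂ → ℂ × ℂ → ℂ) (q : OnePoint ℂ) (p : ℂ × ℂ) : ℂ :=
  ∑' k : ℤ, if k = 0 then 0 else -(lamk (-k) q) * fhat u k q p.2 * ek k p.1

section MultiplierEstimates

open Filter Topology

/-- Continuity on `K` for the sup-norm over `S`, on a general metric space. -/
def SupContinuousOn {X α : Type*} [PseudoMetricSpace X] (K : Set X) (S : Set α)
    (u : X → α → ℂ) : Prop :=
  ∀ q ∈ K, ∀ ε > (0 : ℝ), ∃ δ > (0 : ℝ), ∀ q' ∈ K, dist q' q < δ →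
    ∀ a ∈ S, ‖u q' a - u q a‖ ≤ ε

namespace SupContinuousOn

variable {X Y α : Type*} [PseudoMetricSpace X] [PseudoMetricSpace Y] {K : Set X} {S : Set α}
  {u v : X → α → ℂ}

theorem iff_eventually : SupContinuousOn K S u ↔
    ∀ q ∈ K, ∀ ε > (0 : ℝ), ∀ᶠ q' in 𝓝[K] q, ∀ a ∈ S, ‖u q' a - u q a‖ ≤ ε := by
  simp only [SupContinuousOn, Filter.Eventually, Metric.mem_nhdsWithin_iff]
  refine forall₄_congr fun q _ ε _ => exists_congr fun δ => and_congr Iff.rfl ?_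
  constructor
  · rintro h x ⟨hx, hxK⟩
    exact h x hxK hx
  · intro h x hxK hx
    exact h ⟨hx, hxK⟩

theorem congr (hu : SupContinuousOn K S u) (h : ∀ q ∈ K, ∀ a ∈ S, v q a = u q a) :
    SupContinuousOn K S v := by
  intro q hq ε hε
  obtain ⟨δ, hδ, H⟩ := hu q hq ε hε
  refine ⟨δ, hδ, fun q' hq' hd a ha => ?_⟩
  rw [h q hq a ha, h q' hq' a ha]
  exact H q' hq' hd a ha

theorem of_continuousOn {c : X → ℂ} (hc : ContinuousOn c K) :
    SupContinuousOn K S (fun q _ => c q) := by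
  rw [iff_eventually]
  intro q hq ε hε
  filter_upwards [(Metric.tendsto_nhds.1 (hc q hq)) ε hε] with q' hq' a _
  rw [← dist_eq_norm]
  exact hq'.le

theorem comp {w : Y → α → ℂ} {L : Set Y} {f : X → Y} (hw : SupContinuousOn L S w)
    (hf : ContinuousOn f K) (hfK : MapsTo f K L) : SupContinuousOn K S (fun q => w (f q)) := by
  rw [iff_eventually] at hw ⊢
  intro q hq ε hε
  exact (hf q hq).tendsto_nhdsWithin hfK |>.eventually (hw (f q) (hfK hq) ε hε)

theorem add (hu : SupContinuousOn K S u) (hv : SupContinuousOn K S v) :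
    SupContinuousOn K S (fun q a => u q a + v q a) := by
  rw [iff_eventually] at hu hv ⊢
  intro q hq ε hε
  filter_upwards [hu q hq (ε / 2) (by positivity), hv q hq (ε / 2) (by positivity)]
    with q' h1 h2 a ha
  calc ‖u q' a + v q' a - (u q a + v q a)‖ = ‖(u q' a - u q a) + (v q' a - v q a)‖ := by ring_nf
    _ ≤ ε / 2 + ε / 2 := (norm_add_le _ _).trans (add_le_add (h1 a ha) (h2 a ha))
    _ = ε := by ring

theorem mul {A B : ℝ} (hu : SupContinuousOn K S u) (hv : SupContinuousOn K S v)
    (hA : ∀ q ∈ K, ∀ a ∈ S, ‖u q a‖ ≤ A) (hB : ∀ q ∈ K, ∀ a ∈ S, ‖v q a‖ ≤ B) :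
    SupContinuousOn K S (fun q a => u q a * v q a) := by
  rw [iff_eventually] at hu hv ⊢
  intro q hq ε hε
  have hD : 0 < |A| + |B| + 1 := by positivity
  filter_upwards [hu q hq (ε / (|A| + |B| + 1)) (by positivity),
    hv q hq (ε / (|A| + |B| + 1)) (by positivity), self_mem_nhdsWithin] with q' h1 h2 hq' a ha
  have hA' : ‖u q' a‖ ≤ |A| := (hA q' hq' a ha).trans (le_abs_self A)
  have hB' : ‖v q a‖ ≤ |B| := (hB q hq a ha).trans (le_abs_self B)
  calc ‖u q' a * v q' a - u q a * v q a‖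
      = ‖u q' a * (v q' a - v q a) + (u q' a - u q a) * v q a‖ := by ring_nf
    _ ≤ ‖u q' a‖ * ‖v q' a - v q a‖ + ‖u q' a - u q a‖ * ‖v q a‖ := by
        rw [← norm_mul, ← norm_mul]; exact norm_add_le _ _
    _ ≤ |A| * (ε / (|A| + |B| + 1)) + (ε / (|A| + |B| + 1)) * |B| := by
        gcongr
        · exact h2 a ha
        · exact h1 a ha
    _ = ε * ((|A| + |B|) / (|A| + |B| + 1)) := by ring
    _ ≤ ε * 1 := by
        gcongr
        rw [div_le_one hD]
        linarith
    _ = ε := mul_one ε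

theorem finsetSum {ι : Type*} (s : Finset ι) {w : ι → X → α → ℂ}
    (hw : ∀ i ∈ s, SupContinuousOn K S (w i)) :
    SupContinuousOn K S (fun q a => ∑ i ∈ s, w i q a) := by
  classical
  induction s using Finset.induction_on with
  | empty =>
    intro q _ ε hε
    exact ⟨1, one_pos, fun _ _ _ _ _ => by simpa using hε.le⟩
  | insert i s hi ih =>
    simp only [Finset.sum_insert hi]
    exact (hw i (Finset.mem_insert_self i s)).add
      (ih fun j hj => hw j (Finset.mem_insert_of_mem hj))

theorem tsum {ι : Type*} {w : ι → X → α → ℂ} {A : ι → ℝ} (hA : Summable A)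
    (hw : ∀ i, SupContinuousOn K S (w i)) (hb : ∀ i, ∀ q ∈ K, ∀ a ∈ S, ‖w i q a‖ ≤ A i) :
    SupContinuousOn K S (fun q a => ∑' i, w i q a) := by
  rw [iff_eventually]
  intro q hq ε hε
  obtain ⟨s, hs⟩ := ((tendstoUniformlyOn_tsum (f := fun i (x : X × α) => w i x.1 x.2) (s := K ×ˢ S)
    hA (fun i x hx => hb i x.1 hx.1 x.2 hx.2)) |> Metric.tendstoUniformlyOn_iff.1)
    (ε / 3) (by positivity) |>.exists
  have hF := iff_eventually.1 (finsetSum s fun i _ => hw i) q hq (ε / 3) (by positivity)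
  filter_upwards [hF, self_mem_nhdsWithin] with q' h1 hq' a ha
  have e1 := (hs (q, a) ⟨hq, ha⟩).le
  have e2 := (hs (q', a) ⟨hq', ha⟩).le
  have e3 := h1 a ha
  rw [dist_eq_norm] at e1 e2
  calc _ = ‖(∑' i, w i q' a - ∑ i ∈ s, w i q' a) + (∑ i ∈ s, w i q' a - ∑ i ∈ s, w i q a)
        - (∑' i, w i q a - ∑ i ∈ s, w i q a)‖ := by ring_nf
    _ ≤ ε / 3 + ε / 3 + ε / 3 :=
        (norm_sub_le _ _).trans (add_le_add ((norm_add_le _ _).trans (add_le_add e2 e3)) e1)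
    _ = ε := by ring

end SupContinuousOn

/-- `u` is `C¹`-holomorphic on `K` with derivative `g`, and `u`, `g` and the difference quotient
errors are bounded by `A` in the sup-norm over `S`. -/
structure C1HolBound {α : Type*} (K : Set ℂ) (S : Set α) (u g : ℂ → α → ℂ) (A : ℝ) : Prop where
  cont : SupContinuousOn K S u
  cont_deriv : SupContinuousOn K S g
  cont_omega : SupContinuousOn (K ×ˢ K) S (omegaF u g)
  bound : ∀ q ∈ K, ∀ a ∈ S, ‖u q a‖ ≤ A
  bound_deriv : ∀ q ∈ K, ∀ a ∈ S, ‖g q a‖ ≤ A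
  bound_omega : ∀ p ∈ K ×ˢ K, ∀ a ∈ S, ‖omegaF u g p a‖ ≤ A

theorem omegaF_mul {α : Type*} (c c' : ℂ → ℂ) (u g : ℂ → α → ℂ) (p : ℂ × ℂ) (a : α) :
    omegaF (fun q a => c q * u q a) (fun q a => c' q * u q a + c q * g q a) p a =
      omegaF (fun q _ => c q) (fun q (_ : α) => c' q) p a * u p.1 a + c p.2 * omegaF u g p a
        + (c p.2 - c p.1) * g p.1 a := by
  by_cases h : p.1 = p.2
  · simp [omegaF, h]
  · have : p.2 - p.1 ≠ 0 := sub_ne_zero.2 (Ne.symm h)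
    simp only [omegaF, h, if_false, smul_eq_mul]
    field_simp
    ring

namespace C1HolBound

variable {α : Type*} {K : Set ℂ} {S : Set α} {u g v : ℂ → α → ℂ} {A : ℝ}

theorem fPair (h : C1HolBound K S u g A) : FPair K S u g :=
  ⟨h.cont, h.cont_deriv, h.cont_omega⟩

theorem fBdd (h : C1HolBound K S u g A) : FBdd K S u g := by
  refine ⟨⟨A, ?_⟩, ⟨A, ?_⟩, ⟨A, ?_⟩⟩
  · rintro x ⟨q, hq, a, ha, rfl⟩; exact h.bound q hq a ha
  · rintro x ⟨q, hq, a, ha, rfl⟩; exact h.bound_deriv q hq a ha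
  · rintro x ⟨q, hq, a, ha, rfl⟩; exact h.bound_omega q hq a ha

theorem fNorm_le (h : C1HolBound K S u g A) (hA : 0 ≤ A) : fNorm K S u g ≤ 4 * A := by
  have h0 : fn0 K S u ≤ A := Real.sSup_le (by
    rintro x ⟨q, hq, a, ha, rfl⟩; exact h.bound q hq a ha) hA
  have h1 : fn0 K S g ≤ A := Real.sSup_le (by
    rintro x ⟨q, hq, a, ha, rfl⟩; exact h.bound_deriv q hq a ha) hA
  have h2 : fn2 K S u g ≤ A := Real.sSup_le (by
    rintro x ⟨q, hq, a, ha, rfl⟩; exact h.bound_omega q hq a ha) hA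
  have h3 : fdel K S u ≤ 2 * A := Real.sSup_le (by
    rintro x ⟨q, hq, a, ha, rfl⟩
    have := (norm_sub_le (u q.2 a) (u q.1 a)).trans
      (add_le_add (h.bound _ hq.2 a ha) (h.bound _ hq.1 a ha))
    linarith) (by positivity)
  have : max (fn0 K S g) (fdel K S u) ≤ 2 * A := max_le (by linarith) h3
  simp only [fNorm]
  linarith

theorem congr (h : C1HolBound K S u g A) (huv : ∀ q ∈ K, ∀ a ∈ S, v q a = u q a) :
    C1HolBound K S v g A := by
  have hΩ : ∀ p ∈ K ×ˢ K, ∀ a ∈ S, omegaF v g p a = omegaF u g p a := by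
    intro p hp a ha
    simp only [omegaF, huv _ hp.1 a ha, huv _ hp.2 a ha]
  exact ⟨h.cont.congr huv, h.cont_deriv, h.cont_omega.congr hΩ,
    fun q hq a ha => by rw [huv q hq a ha]; exact h.bound q hq a ha, h.bound_deriv,
    fun p hp a ha => by rw [hΩ p hp a ha]; exact h.bound_omega p hp a ha⟩

theorem _root_.fNorm_nonneg (K : Set ℂ) (S : Set α) (u g : ℂ → α → ℂ) : 0 ≤ fNorm K S u g := by
  have h (T : Set ℝ) (hT : ∀ x ∈ T, 0 ≤ x) : 0 ≤ sSup T := Real.sSup_nonneg hT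
  have h0 : 0 ≤ fn0 K S u := h _ (by rintro x ⟨q, hq, a, ha, rfl⟩; positivity)
  have h1 : 0 ≤ fn0 K S g := h _ (by rintro x ⟨q, hq, a, ha, rfl⟩; positivity)
  have h2 : 0 ≤ fn2 K S u g := h _ (by rintro x ⟨q, hq, a, ha, rfl⟩; positivity)
  have := h1.trans (le_max_left _ (fdel K S u))
  simp only [fNorm]
  linarith

theorem of_fPair (h : FPair K S u g) (hb : FBdd K S u g) : C1HolBound K S u g (fNorm K S u g) := by
  have nn (T : Set ℝ) (hT : ∀ x ∈ T, 0 ≤ x) : 0 ≤ sSup T := Real.sSup_nonneg hT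
  have h0 : 0 ≤ fn0 K S u := nn _ (by rintro x ⟨q, hq, a, ha, rfl⟩; positivity)
  have h1 : 0 ≤ fn0 K S g := nn _ (by rintro x ⟨q, hq, a, ha, rfl⟩; positivity)
  have h2 : 0 ≤ fn2 K S u g := nn _ (by rintro x ⟨q, hq, a, ha, rfl⟩; positivity)
  have h3 := le_max_left (fn0 K S g) (fdel K S u)
  refine ⟨h.1, h.2.1, h.2.2, fun q hq a ha => ?_, fun q hq a ha => ?_, fun p hp a ha => ?_⟩
  · have : ‖u q a‖ ≤ fn0 K S u := le_csSup hb.1 ⟨q, hq, a, ha, rfl⟩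
    simp only [fNorm]; linarith
  · have : ‖g q a‖ ≤ fn0 K S g := le_csSup hb.2.1 ⟨q, hq, a, ha, rfl⟩
    simp only [fNorm]; linarith
  · have : ‖omegaF u g p a‖ ≤ fn2 K S u g := le_csSup hb.2.2 ⟨p, hp, a, ha, rfl⟩
    simp only [fNorm]; linarith

theorem mono {B : ℝ} (h : C1HolBound K S u g A) (hAB : A ≤ B) : C1HolBound K S u g B :=
  ⟨h.cont, h.cont_deriv, h.cont_omega, fun q hq a ha => (h.bound q hq a ha).trans hAB,
    fun q hq a ha => (h.bound_deriv q hq a ha).trans hAB,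
    fun q hq a ha => (h.bound_omega q hq a ha).trans hAB⟩

theorem mul {c c' : ℂ → ℂ} {L : ℝ} (hc : C1HolBound K S (fun q _ => c q) (fun q _ => c' q) L)
    (h : C1HolBound K S u g A) (hL : 0 ≤ L) (hA : 0 ≤ A) :
    C1HolBound K S (fun q a => c q * u q a) (fun q a => c' q * u q a + c q * g q a)
      (4 * (L * A)) := by
  have hLA : 0 ≤ L * A := mul_nonneg hL hA
  have b {x y : ℂ} {s t : ℝ} (hs : 0 ≤ s) (hx : ‖x‖ ≤ s) (hy : ‖y‖ ≤ t) : ‖x * y‖ ≤ s * t := by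
    rw [norm_mul]; gcongr
  have hfst : ContinuousOn (Prod.fst : ℂ × ℂ → ℂ) (K ×ˢ K) := continuousOn_fst
  have hsnd : ContinuousOn (Prod.snd : ℂ × ℂ → ℂ) (K ×ˢ K) := continuousOn_snd
  have mf : MapsTo (Prod.fst : ℂ × ℂ → ℂ) (K ×ˢ K) K := fun p hp => hp.1
  have ms : MapsTo (Prod.snd : ℂ × ℂ → ℂ) (K ×ˢ K) K := fun p hp => hp.2
  have cu1 := h.cont.comp hfst mf
  have cg1 := h.cont_deriv.comp hfst mf
  have cc1 := hc.cont.comp hfst mf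
  have cc2 := hc.cont.comp hsnd ms
  have neg1 : SupContinuousOn (K ×ˢ K) S (fun _ _ => (-1 : ℂ)) :=
    SupContinuousOn.of_continuousOn (c := fun _ => (-1 : ℂ)) continuousOn_const
  have cdc : SupContinuousOn (K ×ˢ K) S (fun p _ => c p.2 - c p.1) :=
    (cc2.add (neg1.mul cc1 (A := 1) (B := L) (by simp)
      (fun p hp a ha => hc.bound p.1 hp.1 a ha))).congr (fun p _ a _ => by ring)
  have bdc : ∀ p ∈ K ×ˢ K, ∀ a ∈ S, ‖c p.2 - c p.1‖ ≤ 2 * L := fun p hp a ha => by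
    have := (norm_sub_le (c p.2) (c p.1)).trans
      (add_le_add (hc.bound _ hp.2 a ha) (hc.bound _ hp.1 a ha))
    linarith
  have bu1 : ∀ p ∈ K ×ˢ K, ∀ a ∈ S, ‖u p.1 a‖ ≤ A := fun p hp => h.bound _ hp.1
  have bg1 : ∀ p ∈ K ×ˢ K, ∀ a ∈ S, ‖g p.1 a‖ ≤ A := fun p hp => h.bound_deriv _ hp.1
  have bc2 : ∀ p ∈ K ×ˢ K, ∀ a ∈ S, ‖c p.2‖ ≤ L := fun p hp => hc.bound _ hp.2
  refine ⟨hc.cont.mul h.cont hc.bound h.bound,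
    (hc.cont_deriv.mul h.cont hc.bound_deriv h.bound).add
      (hc.cont.mul h.cont_deriv hc.bound h.bound_deriv), ?_, ?_, ?_, ?_⟩
  · exact (((hc.cont_omega.mul cu1 hc.bound_omega bu1).add
      (cc2.mul h.cont_omega bc2 h.bound_omega)).add (cdc.mul cg1 bdc bg1)).congr
        (fun p _ a _ => omegaF_mul c c' u g p a)
  · intro q hq a ha
    have := b hL (hc.bound q hq a ha) (h.bound q hq a ha)
    linarith
  · intro q hq a ha
    have e1 := b hL (hc.bound_deriv q hq a ha) (h.bound q hq a ha)
    have e2 := b hL (hc.bound q hq a ha) (h.bound_deriv q hq a ha)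
    have := (norm_add_le _ _).trans (add_le_add e1 e2)
    linarith
  · intro p hp a ha
    rw [omegaF_mul]
    have e1 := b hL (hc.bound_omega p hp a ha) (bu1 p hp a ha)
    have e2 := b hL (bc2 p hp a ha) (h.bound_omega p hp a ha)
    have e3 := b (by positivity) (bdc p hp a ha) (bg1 p hp a ha)
    have := (norm_add_le _ _).trans (add_le_add ((norm_add_le _ _).trans (add_le_add e1 e2)) e3)
    linarith

theorem tsum {ι : Type*} {w w' : ι → ℂ → α → ℂ} {A : ι → ℝ} (hA : Summable A)
    (h : ∀ i, C1HolBound K S (w i) (w' i) (A i)) :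
    C1HolBound K S (fun q a => ∑' i, w i q a) (fun q a => ∑' i, w' i q a) (∑' i, A i) := by
  have hs : ∀ q ∈ K, ∀ a ∈ S, Summable fun i => w i q a := fun q hq a ha =>
    .of_norm_bounded hA fun i => (h i).bound q hq a ha
  have hs' : ∀ q ∈ K, ∀ a ∈ S, Summable fun i => w' i q a := fun q hq a ha =>
    .of_norm_bounded hA fun i => (h i).bound_deriv q hq a ha
  have hΩ : ∀ p ∈ K ×ˢ K, ∀ a ∈ S,
      omegaF (fun q a => ∑' i, w i q a) (fun q a => ∑' i, w' i q a) p a =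
        ∑' i, omegaF (w i) (w' i) p a := by
    intro p hp a ha
    by_cases he : p.1 = p.2
    · simp [omegaF, he]
    · simp only [omegaF, he, if_false, smul_eq_mul]
      have s1 := (hs _ hp.2 a ha).sub (hs _ hp.1 a ha)
      rw [(s1.mul_left _).tsum_sub (hs' _ hp.1 a ha), tsum_mul_left,
        (hs _ hp.2 a ha).tsum_sub (hs _ hp.1 a ha)]
  refine ⟨.tsum hA (fun i => (h i).cont) fun i => (h i).bound,
    .tsum hA (fun i => (h i).cont_deriv) fun i => (h i).bound_deriv,
    (SupContinuousOn.tsum hA (fun i => (h i).cont_omega) fun i => (h i).bound_omega).congr hΩ,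
    fun q hq a ha => ?_, fun q hq a ha => ?_, fun q hq a ha => ?_⟩
  · exact tsum_of_norm_bounded hA.hasSum fun i => (h i).bound q hq a ha
  · exact tsum_of_norm_bounded hA.hasSum fun i => (h i).bound_deriv q hq a ha
  · rw [hΩ q hq a ha]
    exact tsum_of_norm_bounded hA.hasSum fun i => (h i).bound_omega q hq a ha

end C1HolBound

theorem isOpen_Strip (r : ℝ) : IsOpen (Strip r) :=
  isOpen_lt (continuous_abs.comp continuous_im) continuous_const

theorem isOpen_SD (r ρ : ℝ) : IsOpen (SD r ρ) := (isOpen_Strip r).prod isOpen_ball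

theorem Strip_mono {r' r : ℝ} (h : r' ≤ r) : Strip r' ⊆ Strip r :=
  fun _ hz => lt_of_lt_of_le hz h

theorem ek_add (k : ℤ) (θ θ' : ℂ) : ek k (θ + θ') = ek k θ * ek k θ' := by
  rw [ek, ek, ek, ← Complex.exp_add]; ring_nf

theorem ek_one (k : ℤ) : ek k 1 = 1 := by
  rw [ek, mul_one, mul_comm, Complex.exp_int_mul_two_pi_mul_I]

theorem ek_add_one (k : ℤ) (θ : ℂ) : ek k (θ + 1) = ek k θ := by
  rw [ek_add, ek_one, mul_one]

theorem ek_int_add (k l : ℤ) (θ : ℂ) : ek (k + l) θ = ek k θ * ek l θ := by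
  rw [ek, ek, ek, ← Complex.exp_add]; push_cast; ring_nf

theorem ek_neg_eq (k : ℤ) (θ : ℂ) : ek (-k) θ = Complex.exp (-(2 * Real.pi * Complex.I * k * θ)) := by
  rw [ek]; push_cast; ring_nf

theorem norm_ek (k : ℤ) (θ : ℂ) : ‖ek k θ‖ = Real.exp (-(2 * Real.pi * k * θ.im)) := by
  rw [ek, Complex.norm_exp]
  congr 1
  simp [Complex.mul_re, Complex.mul_im]

theorem differentiable_ek (k : ℤ) : Differentiable ℂ (ek k) := by
  unfold ek; fun_prop

theorem deriv_ek (k : ℤ) (θ : ℂ) : deriv (ek k) θ = 2 * Real.pi * Complex.I * k * ek k θ := by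
  have h : HasDerivAt (ek k) (Complex.exp (2 * Real.pi * Complex.I * k * θ) *
      (2 * Real.pi * Complex.I * k * 1)) θ :=
    ((hasDerivAt_id θ).const_mul (2 * Real.pi * Complex.I * k : ℂ)).cexp
  rw [h.deriv, ek]; ring

theorem norm_ek_le {r' : ℝ} (k : ℤ) {θ : ℂ} (hθ : θ ∈ Strip r') :
    ‖ek k θ‖ ≤ Real.exp (2 * Real.pi * |(k : ℝ)| * r') := by
  rw [norm_ek, Real.exp_le_exp]
  have : -((k : ℝ) * θ.im) ≤ |(k : ℝ)| * r' :=
    calc _ ≤ |(k : ℝ) * θ.im| := neg_le_abs _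
      _ = |(k : ℝ)| * |θ.im| := abs_mul _ _
      _ ≤ _ := by gcongr; exact le_of_lt hθ
  nlinarith [Real.pi_pos]

/-- The `k`-th Fourier coefficient of a `1`-periodic function. -/
def perCoeff (f : ℂ → ℂ) (k : ℤ) : ℂ :=
  ∫ t in (0 : ℝ)..1, f t * Complex.exp (-(2 * Real.pi * Complex.I * k * t))

/-- Holomorphic `1`-periodic functions on the strip `S_r`. -/
structure PerHol (r : ℝ) (f : ℂ → ℂ) : Prop where
  periodic : ∀ θ ∈ Strip r, f (θ + 1) = f θ
  diff : DifferentiableOn ℂ f (Strip r)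

namespace PerHol

variable {r : ℝ} {f g : ℂ → ℂ}

theorem sub (hf : PerHol r f) (hg : PerHol r g) : PerHol r (fun θ => f θ - g θ) :=
  ⟨fun θ h => by rw [hf.periodic θ h, hg.periodic θ h], hf.diff.sub hg.diff⟩

theorem const_mul (c : ℂ) (hf : PerHol r f) : PerHol r (fun θ => c * f θ) :=
  ⟨fun θ h => by rw [hf.periodic θ h], hf.diff.const_mul c⟩

theorem mul_ek (hf : PerHol r f) (k : ℤ) : PerHol r (fun θ => f θ * ek k θ) :=
  ⟨fun θ h => by rw [hf.periodic θ h, ek_add_one], hf.diff.mul (differentiable_ek k).differentiableOn⟩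

theorem continuous_line (hf : PerHol r f) {y : ℝ} (hy : |y| < r) :
    Continuous (fun t : ℝ => f (t + y * I)) :=
  hf.diff.continuousOn.comp_continuous (by fun_prop) fun t => by simpa [Strip] using hy

theorem continuous_real (hf : PerHol r f) (hr : 0 < r) : Continuous (fun t : ℝ => f t) := by
  simpa using hf.continuous_line (y := 0) (by simpa using hr)

theorem integral_line (hf : PerHol r f) {y : ℝ} (hy : |y| < r) :
    ∫ t in (0 : ℝ)..1, f (t + y * I) = ∫ t in (0 : ℝ)..1, f t := by
  have H := integral_boundary_rect_eq_zero_of_differentiableOn f 0 (1 + y * I) (hf.diff.mono (by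
    rintro z ⟨-, hz⟩
    have hz : z.im ∈ uIcc (0 : ℝ) y := by simpa using hz
    have := abs_sub_left_of_mem_uIcc hz
    simp only [sub_zero] at this
    exact this.trans_lt hy))
  have e : ∫ x in (0 : ℝ)..y, f (1 + x * I) = ∫ x in (0 : ℝ)..y, f (x * I) := by
    refine intervalIntegral.integral_congr fun x hx => ?_
    have := abs_sub_left_of_mem_uIcc hx
    simp only [sub_zero] at this
    rw [← hf.periodic (x * I) (by simpa [Strip] using this.trans_lt hy), add_comm]
  simp only [zero_re, add_re, one_re, mul_re, ofReal_re, I_re, mul_zero, ofReal_im, I_im,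
    mul_one, sub_self, add_zero, zero_im, add_im, one_im, mul_im, zero_add, ofReal_zero, zero_mul,
    ofReal_one, e] at H
  linear_combination -H

theorem perCoeff_eq_line (hf : PerHol r f) (k : ℤ) {y : ℝ} (hy : |y| < r) :
    perCoeff f k = ∫ t in (0 : ℝ)..1, f (t + y * I) * ek (-k) (t + y * I) := by
  rw [(hf.mul_ek (-k)).integral_line hy]
  simp only [perCoeff, ek_neg_eq]

theorem norm_perCoeff_le (hf : PerHol r f) (hr : 0 < r) (k : ℤ) {A : ℝ}
    (hA : ∀ θ ∈ Strip r, ‖f θ‖ ≤ A) :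
    ‖perCoeff f k‖ ≤ A * Real.exp (-(2 * Real.pi * |(k : ℝ)| * r)) := by
  have key : ∀ s ∈ Ioo 0 r, ‖perCoeff f k‖ ≤ A * Real.exp (-(2 * Real.pi * |(k : ℝ)| * s)) := by
    rintro s ⟨hs0, hs⟩
    obtain ⟨y, hy, hky⟩ : ∃ y : ℝ, |y| < r ∧ (k : ℝ) * y = -(|(k : ℝ)| * s) := by
      rcases le_total 0 (k : ℝ) with h | h
      · exact ⟨-s, by rwa [abs_neg, abs_of_pos hs0], by rw [abs_of_nonneg h]; ring⟩
      · exact ⟨s, by rwa [abs_of_pos hs0], by rw [abs_of_nonpos h]; ring⟩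
    rw [hf.perCoeff_eq_line k hy]
    refine (intervalIntegral.norm_integral_le_of_norm_le_const (C := A *
      Real.exp (-(2 * Real.pi * |(k : ℝ)| * s))) fun t _ => ?_).trans_eq (by simp)
    rw [norm_mul, norm_ek]
    have h1 := hA (t + y * I) (by simpa [Strip] using hy)
    have h2 : -(2 * Real.pi * ((-k : ℤ) : ℝ) * ((t : ℂ) + y * I).im)
        = -(2 * Real.pi * |(k : ℝ)| * s) := by
      simp only [add_im, ofReal_im, mul_im, ofReal_re, I_im, mul_one, I_re, mul_zero, add_zero,
        zero_add]
      push_cast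
      linear_combination 2 * Real.pi * hky
    rw [h2]
    gcongr
  have hc : Tendsto (fun s : ℝ => A * Real.exp (-(2 * Real.pi * |(k : ℝ)| * s))) (𝓝[<] r)
      (𝓝 (A * Real.exp (-(2 * Real.pi * |(k : ℝ)| * r)))) :=
    (Continuous.tendsto (by fun_prop) r).mono_left nhdsWithin_le_nhds
  refine ge_of_tendsto hc ?_
  filter_upwards [Ioo_mem_nhdsLT hr] with s hs using key s hs

theorem norm_term_le (hf : PerHol r f) (hr : 0 < r) (k : ℤ) {A r' : ℝ}
    (hA : ∀ θ ∈ Strip r, ‖f θ‖ ≤ A) {θ : ℂ} (hθ : θ ∈ Strip r') :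
    ‖perCoeff f k * ek k θ‖ ≤ Real.exp (-(2 * Real.pi * |(k : ℝ)| * (r - r'))) * A := by
  have h0 : 0 ≤ A := (norm_nonneg _).trans (hA 0 (by simpa [Strip] using hr))
  calc ‖perCoeff f k * ek k θ‖ ≤ A * Real.exp (-(2 * Real.pi * |(k : ℝ)| * r)) *
        Real.exp (2 * Real.pi * |(k : ℝ)| * r') := by
        rw [norm_mul]
        gcongr
        · exact hf.norm_perCoeff_le hr k hA
        · exact norm_ek_le k hθ
    _ = _ := by
        rw [mul_assoc, ← Real.exp_add, mul_comm]; ring_nf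

theorem perCoeff_sub (hf : PerHol r f) (hg : PerHol r g) (hr : 0 < r) (k : ℤ) :
    perCoeff (fun θ => f θ - g θ) k = perCoeff f k - perCoeff g k := by
  simp only [perCoeff, sub_mul]
  have hf' := hf.continuous_real hr
  have hg' := hg.continuous_real hr
  exact intervalIntegral.integral_sub
    (Continuous.intervalIntegrable (hf'.mul (by fun_prop)) _ _)
    (Continuous.intervalIntegrable (hg'.mul (by fun_prop)) _ _)

end PerHol

theorem perCoeff_const_mul (c : ℂ) (f : ℂ → ℂ) (k : ℤ) :
    perCoeff (fun θ => c * f θ) k = c * perCoeff f k := by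
  simp only [perCoeff, mul_assoc, intervalIntegral.integral_const_mul]

theorem summable_exp_neg_abs {d : ℝ} (hd : 0 < d) :
    Summable fun k : ℤ => Real.exp (-(2 * Real.pi * |(k : ℝ)| * d)) := by
  have h : Summable fun n : ℕ => Real.exp (-(2 * Real.pi * (n : ℝ) * d)) := by
    refine (Real.summable_exp_nat_mul_iff (a := -(2 * Real.pi * d)).2 (by
      have := Real.pi_pos; nlinarith [mul_pos this hd])).congr fun n => ?_
    ring_nf
  refine Summable.of_nat_of_neg ?_ ?_
  · simpa using h
  · simpa using h

theorem PerHol.hasSum {r : ℝ} {f : ℂ → ℂ} (hf : PerHol r f) {A : ℝ}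
    (hA : ∀ θ ∈ Strip r, ‖f θ‖ ≤ A) {θ : ℂ} (hθ : θ ∈ Strip r) :
    HasSum (fun k : ℤ => perCoeff f k * ek k θ) (f θ) := by
  have hr : 0 < r := (abs_nonneg _).trans_lt hθ
  set x := θ.re with hx
  set y := θ.im with hyd
  have hy : |y| < r := hθ
  have hθe : θ = x + y * I := (re_add_im θ).symm
  have hper : Function.Periodic (fun t : ℝ => f (t + y * I)) 1 := fun t => by
    have := hf.periodic (t + y * I) (by simpa [Strip] using hy)
    simp only [ofReal_add, ofReal_one]
    rw [← this]; ring_nf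
  have hcont : Continuous (hper.lift : AddCircle (1 : ℝ) → ℂ) :=
    continuous_coinduced_dom.2 (hf.continuous_line hy)
  let F : C(AddCircle (1 : ℝ), ℂ) := ⟨hper.lift, hcont⟩
  have hFx : ∀ t : ℝ, F (t : AddCircle (1 : ℝ)) = f (t + y * I) := fun t => rfl
  have four : ∀ (k : ℤ) (t : ℝ), fourier k (t : AddCircle (1 : ℝ)) = ek k t := fun k t => by
    rw [fourier_coe_apply, ek]; simp
  have hco : ∀ k : ℤ, fourierCoeff F k = perCoeff f k * ek k (y * I) := fun k => by
    rw [fourierCoeff_eq_intervalIntegral F k 0, hf.perCoeff_eq_line k hy,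
      ← intervalIntegral.integral_mul_const]
    simp only [one_div, inv_one, one_smul, zero_add, smul_eq_mul]
    refine intervalIntegral.integral_congr fun t _ => ?_
    simp only [hFx, four, ek_add]
    have : ek (-k) (y * I) * ek k (y * I) = 1 := by
      rw [← ek_int_add]; simp [ek]
    linear_combination (-(f (t + y * I) * ek (-k) t)) * this
  have hco' : ∀ k : ℤ, fourierCoeff F k * ek k x = perCoeff f k * ek k θ := fun k => by
    rw [hco, hθe, ek_add]; ring
  have hsum : Summable (fourierCoeff F) := by
    refine .of_norm_bounded ((summable_exp_neg_abs (sub_pos.2 hy)).mul_right A) fun k => ?_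
    rw [hco]
    set s := |y|
    have h0 : 0 ≤ A := (norm_nonneg _).trans (hA 0 (by simpa [Strip] using hr))
    calc ‖perCoeff f k * ek k (y * I)‖ ≤ A * Real.exp (-(2 * Real.pi * |(k : ℝ)| * r)) *
          Real.exp (2 * Real.pi * |(k : ℝ)| * s) := by
          rw [norm_mul]
          gcongr
          · exact hf.norm_perCoeff_le hr k hA
          · rw [norm_ek, Real.exp_le_exp]
            have : -((k : ℝ) * y) ≤ |(k : ℝ)| * s := by
              rw [← abs_mul]; exact neg_le_abs _
            simp only [mul_im, ofReal_re, I_im, mul_one, ofReal_im, I_re, mul_zero, add_zero]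
            nlinarith [Real.pi_pos]
      _ = _ := by rw [mul_assoc, ← Real.exp_add, mul_comm]; ring_nf
  have := has_pointwise_sum_fourier_series_of_summable hsum (x : AddCircle (1 : ℝ))
  rw [hFx, ← hθe] at this
  simpa only [smul_eq_mul, four, hco'] using this

theorem perCoeff_ek (j k : ℤ) : perCoeff (ek j) k = if j = k then 1 else 0 := by
  have : perCoeff (ek j) k = ∫ t in (0 : ℝ)..1, ek (j - k) t := by
    refine intervalIntegral.integral_congr fun t _ => ?_
    simp only [← ek_neg_eq, ← ek_int_add, sub_eq_add_neg]
  rw [this]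
  split_ifs with h
  · simp [h, ek]
  · have h0 : (2 * Real.pi * I * ((j - k : ℤ) : ℂ)) ≠ 0 := by
      have : ((j - k : ℤ) : ℂ) ≠ 0 := Int.cast_ne_zero.2 (sub_ne_zero.2 h)
      exact mul_ne_zero (by simp [Real.pi_ne_zero]) this
    have h1 := integral_exp_mul_complex (a := 0) (b := 1) h0
    simp only [ek]
    rw [h1]
    have := ek_one (j - k)
    rw [ek] at this
    simp only [ofReal_one, this]
    simp

theorem perCoeff_tsum {a : ℤ → ℂ} (ha : Summable fun k => ‖a k‖) (k : ℤ) :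
    perCoeff (fun θ => ∑' j, a j * ek j θ) k = a k := by
  have hn : ∀ (j : ℤ) (t : ℝ), ‖ek j t‖ = 1 := fun j t => by rw [norm_ek]; simp
  have hs : ∀ t : ℝ, Summable fun j => a j * ek j t := fun t =>
    .of_norm_bounded ha fun j => by rw [norm_mul, hn, mul_one]
  have H := intervalIntegral.hasSum_integral_of_dominated_convergence (a := 0) (b := 1)
    (μ := MeasureTheory.volume) (F := fun (j : ℤ) (t : ℝ) => a j * ek j t * ek (-k) t)
    (f := fun t => (∑' j, a j * ek j t) * ek (-k) t) (fun j _ => ‖a j‖)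
    (fun j => Continuous.aestronglyMeasurable (by
      have h1 := (differentiable_ek j).continuous
      have h2 := (differentiable_ek (-k)).continuous
      fun_prop))
    (fun j => .of_forall fun t _ => by rw [norm_mul, norm_mul, hn, hn]; simp)
    (.of_forall fun _ _ => ha) (by simp)
    (.of_forall fun t _ => (hs t).hasSum.mul_right _)
  have e : ∀ j, ∫ t in (0 : ℝ)..1, a j * ek j t * ek (-k) t = if j = k then a k else 0 := fun j => by
    have := perCoeff_ek j k
    simp only [perCoeff, ← ek_neg_eq] at this
    simp only [mul_assoc, intervalIntegral.integral_const_mul, this]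
    split_ifs with h <;> simp [h]
  simp only [e] at H
  have := H.unique (hasSum_ite_eq k (a k))
  rw [← this]
  simp only [perCoeff, ek_neg_eq]

theorem norm_fderiv_le_of_norm_le {E : Type*} [NormedAddCommGroup E] [NormedSpace ℂ E]
    {f : E → ℂ} {x : E} {δ A : ℝ} (hδ : 0 < δ) (hf : DifferentiableOn ℂ f (ball x δ))
    (hA : ∀ y ∈ ball x δ, ‖f y‖ ≤ A) : ‖fderiv ℂ f x‖ ≤ 2 * A / δ := by
  refine norm_fderiv_le_div_of_mapsTo_ball hf (fun y hy => ?_) hδ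
  rw [mem_closedBall, dist_eq_norm]
  have := (norm_sub_le (f y) (f x)).trans (add_le_add (hA y hy) (hA x (mem_ball_self hδ)))
  linarith

theorem differentiableOn_tsum_of_norm_le {E ι : Type*} [NormedAddCommGroup E] [NormedSpace ℂ E]
    {U : Set E} (hU : IsOpen U) {f : ι → E → ℂ} {u : ι → ℝ} (hu : Summable u)
    (hf : ∀ i, DifferentiableOn ℂ (f i) U) (hb : ∀ i, ∀ x ∈ U, ‖f i x‖ ≤ u i) :
    DifferentiableOn ℂ (fun x => ∑' i, f i x) U := by
  intro x hx
  obtain ⟨η, hη, hηU⟩ := Metric.isOpen_iff.1 hU x hx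
  have hsub : ∀ y ∈ ball x (η / 2), ball y (η / 2) ⊆ U := fun y hy =>
    (ball_subset_ball' (by rw [mem_ball] at hy; linarith)).trans hηU
  have hx' : x ∈ ball x (η / 2) := mem_ball_self (by positivity)
  refine (hasFDerivAt_tsum_of_isPreconnected (f' := fun i y => fderiv ℂ (f i) y)
    ((hu.mul_left 2).div_const (η / 2)) isOpen_ball
    (convex_ball x (η / 2)).isPreconnected ?_ ?_ hx' ?_ hx').differentiableAt.differentiableWithinAt
  · intro i y hy
    exact ((hf i).differentiableAt
      (hU.mem_nhds (hsub y hy (mem_ball_self (by positivity))))).hasFDerivAt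
  · intro i y hy
    exact norm_fderiv_le_of_norm_le (by positivity) ((hf i).mono (hsub y hy))
      fun z hz => hb i z (hsub y hy hz)
  · exact .of_norm_bounded hu fun i => hb i x hx

theorem differentiableOn_perCoeff {r ρ A : ℝ} (hr : 0 < r) {v : ℂ × ℂ → ℂ}
    (hv : DifferentiableOn ℂ v (SD r ρ)) (hA : ∀ p ∈ SD r ρ, ‖v p‖ ≤ A) (k : ℤ) :
    DifferentiableOn ℂ (fun ε => perCoeff (fun θ => v (θ, ε)) k) (ball 0 ρ) := by
  intro ε₀ hε₀
  obtain ⟨η, hη, hηU⟩ := Metric.isOpen_iff.1 (isOpen_ball (x := (0 : ℂ)) (ε := ρ)) ε₀ hε₀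
  have hreal : ∀ t : ℝ, (t : ℂ) ∈ Strip r := fun t => by simpa [Strip] using hr
  set F : ℂ → ℝ → ℂ := fun ε t => v (t, ε) * Complex.exp (-(2 * Real.pi * Complex.I * k * t))
  have hexp : ∀ t : ℝ, ‖Complex.exp (-(2 * Real.pi * Complex.I * k * t))‖ = 1 := fun t => by
    rw [← ek_neg_eq, norm_ek]; simp
  have hFc : ∀ ε ∈ ball (0 : ℂ) ρ, Continuous (F ε) := fun ε hε =>
    (hv.continuousOn.comp_continuous (f := fun t : ℝ => ((t : ℂ), ε)) (by fun_prop)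
      fun t => ⟨hreal t, hε⟩).mul (by fun_prop)
  have hFd : ∀ t : ℝ, DifferentiableOn ℂ (fun ε => F ε t) (ball 0 ρ) := fun t =>
    (hv.comp (f := fun ε : ℂ => ((t : ℂ), ε)) (by fun_prop)
      fun ε hε => ⟨hreal t, hε⟩).mul_const _
  have hFb : ∀ (t : ℝ), ∀ ε ∈ ball (0 : ℂ) ρ, ‖F ε t‖ ≤ A := fun t ε hε => by
    simp only [F, norm_mul, hexp, mul_one]
    exact hA _ ⟨hreal t, hε⟩
  have hFD : ∀ (t : ℝ), ∀ ε ∈ ball (0 : ℂ) ρ,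
      HasDerivAt (fun x => F x t) (deriv (fun x => F x t) ε) ε := fun t ε hε =>
    ((hFd t).differentiableAt (isOpen_ball.mem_nhds hε)).hasDerivAt
  have hsub : ∀ ε ∈ ball ε₀ (η / 2), ball ε (η / 2) ⊆ ball (0 : ℂ) ρ := fun y hy =>
    (ball_subset_ball' (by rw [mem_ball] at hy; linarith)).trans hηU
  have hmeas : MeasureTheory.AEStronglyMeasurable (fun t : ℝ => deriv (fun x => F x t) ε₀)
      (MeasureTheory.volume.restrict (uIoc (0 : ℝ) 1)) := by
    let s : ℕ → ℂ := fun n => ((η / 2 / (n + 1) : ℝ) : ℂ)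
    have hs0 : ∀ n, s n ≠ 0 := fun n => by
      simp only [s, ne_eq, ofReal_eq_zero]; positivity
    have hsb : ∀ n, ε₀ + s n ∈ ball (0 : ℂ) ρ := fun n => hηU (by
      rw [mem_ball, dist_eq_norm, add_sub_cancel_left, Complex.norm_real, Real.norm_eq_abs,
        abs_of_pos (by positivity)]
      calc η / 2 / ((n : ℝ) + 1) ≤ η / 2 := div_le_self (by positivity) (by linarith [n.cast_nonneg (α := ℝ)])
        _ < η := by linarith)
    have hst : Tendsto s atTop (𝓝[≠] 0) := by
      refine tendsto_nhdsWithin_iff.2 ⟨?_, .of_forall hs0⟩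
      have := tendsto_const_div_atTop_nhds_zero_nat (𝕜 := ℝ) (η / 2)
      have h1 := (tendsto_add_atTop_iff_nat (f := fun n : ℕ => η / 2 / (n : ℝ)) 1).2 this
      have h2 := (continuous_ofReal.tendsto (0 : ℝ)).comp h1
      simpa [s, Function.comp_def] using h2
    refine aestronglyMeasurable_of_tendsto_ae atTop
      (f := fun n t => (s n)⁻¹ • (F (ε₀ + s n) t - F ε₀ t)) (fun n => ?_) (.of_forall fun t => ?_)
    · exact Continuous.aestronglyMeasurable
        (((hFc _ (hsb n)).sub (hFc _ hε₀)).const_smul (s n)⁻¹)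
    · exact ((hasDerivAt_iff_tendsto_slope_zero).1 (hFD t ε₀ hε₀)).comp hst
  have key := intervalIntegral.hasDerivAt_integral_of_dominated_loc_of_deriv_le
    (μ := MeasureTheory.volume) (a := 0) (b := 1) (F := F)
    (F' := fun ε t => deriv (fun x => F x t) ε) (x₀ := ε₀) (s := ball ε₀ (η / 2))
    (bound := fun _ => 2 * A / (η / 2)) (ball_mem_nhds _ (by positivity)) ?_
    ((hFc ε₀ hε₀).intervalIntegrable _ _) hmeas ?_ (by simp) ?_
  · exact key.2.differentiableAt.differentiableWithinAt
  · filter_upwards [isOpen_ball.mem_nhds hε₀] with ε hε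
    exact (hFc ε hε).aestronglyMeasurable
  · refine .of_forall fun t _ ε hε => ?_
    rw [norm_deriv_eq_norm_fderiv]
    exact norm_fderiv_le_of_norm_le (by positivity) ((hFd t).mono (hsub ε hε))
      fun z hz => hFb t z (hsub ε hε hz)
  · exact .of_forall fun t _ ε hε => hFD t ε (hsub ε hε (mem_ball_self (by positivity)))

/-- The `k`-th term of the Fourier series in `θ` of a function of `(θ, ε)`. -/
def fourierTerm (k : ℤ) (v : ℂ × ℂ → ℂ) (p : ℂ × ℂ) : ℂ :=
  perCoeff (fun θ => v (θ, p.2)) k * ek k p.1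

/-- Functions of `(θ, ε)` that are holomorphic and `1`-periodic in `θ ∈ S_r` for all `ε ∈ D_ρ`. -/
def SliceHol (r ρ : ℝ) (v : ℂ × ℂ → ℂ) : Prop :=
  ∀ ε ∈ ball (0 : ℂ) ρ, PerHol r (fun θ => v (θ, ε))

section Slice

variable {r r' ρ A : ℝ} {v w : ℂ × ℂ → ℂ}

theorem ValHol.sliceHol (hv : ValHol r ρ v) : SliceHol r ρ v := fun ε hε =>
  ⟨fun θ _ => hv.1 θ ε, hv.2.comp (f := fun θ : ℂ => (θ, ε)) (by fun_prop) fun _ hθ => ⟨hθ, hε⟩⟩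

theorem SliceHol.sub (hv : SliceHol r ρ v) (hw : SliceHol r ρ w) :
    SliceHol r ρ (fun p => v p - w p) := fun ε hε => (hv ε hε).sub (hw ε hε)

theorem SliceHol.const_mul (c : ℂ) (hv : SliceHol r ρ v) : SliceHol r ρ (fun p => c * v p) :=
  fun ε hε => (hv ε hε).const_mul c

theorem sliceHol_zero : SliceHol r ρ (fun _ => 0) :=
  fun _ _ => ⟨fun _ _ => rfl, differentiableOn_const 0⟩

theorem fourierTerm_sub (hr : 0 < r) (hv : SliceHol r ρ v) (hw : SliceHol r ρ w) (k : ℤ)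
    {p : ℂ × ℂ} (hp : p ∈ SD r' ρ) :
    fourierTerm k (fun p => v p - w p) p = fourierTerm k v p - fourierTerm k w p := by
  rw [fourierTerm, (hv p.2 hp.2).perCoeff_sub (hw p.2 hp.2) hr, sub_mul]; rfl

theorem fourierTerm_const_mul (c : ℂ) (v : ℂ × ℂ → ℂ) (k : ℤ) (p : ℂ × ℂ) :
    fourierTerm k (fun p => c * v p) p = c * fourierTerm k v p := by
  rw [fourierTerm, perCoeff_const_mul, mul_assoc]; rfl

theorem norm_fourierTerm_le (hr : 0 < r) (hv : SliceHol r ρ v) (hA : ∀ p ∈ SD r ρ, ‖v p‖ ≤ A)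
    (k : ℤ) {p : ℂ × ℂ} (hp : p ∈ SD r' ρ) :
    ‖fourierTerm k v p‖ ≤ Real.exp (-(2 * Real.pi * |(k : ℝ)| * (r - r'))) * A :=
  (hv p.2 hp.2).norm_term_le hr k (fun θ hθ => hA (θ, p.2) ⟨hθ, hp.2⟩) hp.1

theorem differentiableOn_fourierTerm (hr : 0 < r) (hv : DifferentiableOn ℂ v (SD r ρ))
    (hA : ∀ p ∈ SD r ρ, ‖v p‖ ≤ A) (k : ℤ) : DifferentiableOn ℂ (fourierTerm k v) (SD r' ρ) :=
  ((differentiableOn_perCoeff hr hv hA k).comp differentiableOn_snd fun _ hp => hp.2).mul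
    ((differentiable_ek k).comp differentiable_fst).differentiableOn

theorem fourierTerm_add_one (k : ℤ) (v : ℂ × ℂ → ℂ) (θ ε : ℂ) :
    fourierTerm k v (θ + 1, ε) = fourierTerm k v (θ, ε) := by
  simp only [fourierTerm, ek_add_one]

theorem SupContinuousOn.fourierTerm {X : Type*} [PseudoMetricSpace X] {K : Set X}
    {w : X → ℂ × ℂ → ℂ} (hr : 0 < r) (h : SupContinuousOn K (SD r ρ) w)
    (hw : ∀ q ∈ K, SliceHol r ρ (w q)) (k : ℤ) :
    SupContinuousOn K (SD r' ρ) (fun q => fourierTerm k (w q)) := by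
  rw [SupContinuousOn.iff_eventually] at h ⊢
  intro q hq ε hε
  set e := Real.exp (-(2 * Real.pi * |(k : ℝ)| * (r - r')))
  have he : 0 < e := Real.exp_pos _
  filter_upwards [h q hq (ε / e) (by positivity), self_mem_nhdsWithin] with q' hq' hqK p hp
  rw [← fourierTerm_sub hr (hw q' hqK) (hw q hq) k hp]
  refine (norm_fourierTerm_le hr ((hw q' hqK).sub (hw q hq)) hq' k hp).trans_eq ?_
  exact mul_div_cancel₀ ε he.ne'

variable {K : Set ℂ} {U G : ℂ → ℂ × ℂ → ℂ}

theorem SliceHol.omegaF (hU : ∀ q ∈ K, SliceHol r ρ (U q)) (hG : ∀ q ∈ K, SliceHol r ρ (G q)) :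
    ∀ p ∈ K ×ˢ K, SliceHol r ρ (omegaF U G p) := by
  intro p hp
  by_cases he : p.1 = p.2
  · have : _root_.omegaF U G p = fun _ => 0 := by ext a; simp [_root_.omegaF, he]
    rw [this]
    exact sliceHol_zero
  · have : _root_.omegaF U G p = fun a => (p.2 - p.1)⁻¹ * (U p.2 a - U p.1 a) - G p.1 a := by
      ext a; simp [_root_.omegaF, he]
    rw [this]
    exact (((hU _ hp.2).sub (hU _ hp.1)).const_mul _).sub (hG _ hp.1)

theorem omegaF_fourierTerm (hr : 0 < r) (hU : ∀ q ∈ K, SliceHol r ρ (U q))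
    (hG : ∀ q ∈ K, SliceHol r ρ (G q)) (k : ℤ) {p : ℂ × ℂ} (hp : p ∈ K ×ˢ K) {a : ℂ × ℂ}
    (ha : a ∈ SD r' ρ) :
    omegaF (fun q => fourierTerm k (U q)) (fun q => fourierTerm k (G q)) p a =
      fourierTerm k (omegaF U G p) a := by
  by_cases he : p.1 = p.2
  · have : _root_.omegaF U G p = fun _ => 0 := by ext a; simp [_root_.omegaF, he]
    rw [this]
    simp [omegaF, he, fourierTerm, perCoeff]
  · have : _root_.omegaF U G p = fun a => (p.2 - p.1)⁻¹ * (U p.2 a - U p.1 a) - G p.1 a := by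
      ext a; simp [_root_.omegaF, he]
    rw [this, fourierTerm_sub hr (((hU _ hp.2).sub (hU _ hp.1)).const_mul _) (hG _ hp.1) k ha,
      fourierTerm_const_mul, fourierTerm_sub hr (hU _ hp.2) (hU _ hp.1) k ha]
    simp [omegaF, he]

theorem C1HolBound.fourierTerm (hr : 0 < r) (h : C1HolBound K (SD r ρ) U G A)
    (hU : ∀ q ∈ K, SliceHol r ρ (U q)) (hG : ∀ q ∈ K, SliceHol r ρ (G q)) (k : ℤ) :
    C1HolBound K (SD r' ρ) (fun q => fourierTerm k (U q)) (fun q => fourierTerm k (G q))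
      (Real.exp (-(2 * Real.pi * |(k : ℝ)| * (r - r'))) * A) := by
  have hΩ := SliceHol.omegaF hU hG
  exact ⟨h.cont.fourierTerm hr hU k, h.cont_deriv.fourierTerm hr hG k,
    (h.cont_omega.fourierTerm hr hΩ k).congr
      fun p hp a ha => omegaF_fourierTerm hr hU hG k hp ha,
    fun q hq a ha => norm_fourierTerm_le hr (hU q hq) (h.bound q hq) k ha,
    fun q hq a ha => norm_fourierTerm_le hr (hG q hq) (h.bound_deriv q hq) k ha,
    fun p hp a ha => by
      rw [omegaF_fourierTerm hr hU hG k hp ha]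
      exact norm_fourierTerm_le hr (hΩ p hp) (h.bound_omega p hp) k ha⟩

theorem C1HolBound.sliceHol_deriv (h : C1HolBound K (SD r ρ) U G A)
    (hU : ∀ q ∈ K, SliceHol r ρ (U q)) {q : ℂ} (hq : q ∈ K) (hacc : (𝓝[K \ {q}] q).NeBot) :
    SliceHol r ρ (G q) := by
  have hlim : TendstoUniformlyOn (fun q' a => (q' - q)⁻¹ * (U q' a - U q a)) (G q)
      (𝓝[K \ {q}] q) (SD r ρ) := by
    rw [Metric.tendstoUniformlyOn_iff]
    intro ε hε
    obtain ⟨δ, hδ, H⟩ := h.cont_omega (q, q) ⟨hq, hq⟩ (ε / 2) (by positivity)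
    filter_upwards [mem_nhdsWithin_of_mem_nhds (ball_mem_nhds q hδ), self_mem_nhdsWithin]
      with q' hq' hK a ha
    have hne : q ≠ q' := fun h => hK.2 h.symm
    have := H (q, q') ⟨hq, hK.1⟩ (by simpa [Prod.dist_eq, hδ] using hq') a ha
    simp only [omegaF, hne, if_false, smul_eq_mul, if_true, sub_zero] at this
    rw [dist_comm, dist_eq_norm]
    linarith
  have hev : ∀ᶠ q' in 𝓝[K \ {q}] q, SliceHol r ρ fun a => (q' - q)⁻¹ * (U q' a - U q a) := by
    filter_upwards [self_mem_nhdsWithin] with q' hK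
    exact ((hU q' hK.1).sub (hU q hq)).const_mul _
  intro ε hε
  constructor
  · intro θ hθ
    have hθ' : θ + 1 ∈ Strip r := by simpa [Strip] using hθ
    refine tendsto_nhds_unique (hlim.tendsto_at (x := (θ + 1, ε)) ⟨hθ', hε⟩)
      ((hlim.tendsto_at (x := (θ, ε)) ⟨hθ, hε⟩).congr' ?_)
    filter_upwards [hev] with q' hq'
    exact ((hq' ε hε).periodic θ hθ).symm
  · have h2 : TendstoUniformlyOn (fun q' θ => (q' - q)⁻¹ * (U q' (θ, ε) - U q (θ, ε)))
        (fun θ => G q (θ, ε)) (𝓝[K \ {q}] q) (Strip r) :=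
      (hlim.comp (fun θ : ℂ => (θ, ε))).mono fun θ hθ => ⟨hθ, hε⟩
    refine h2.tendstoLocallyUniformlyOn.differentiableOn ?_ (isOpen_Strip r)
    filter_upwards [hev] with q' hq'
    exact (hq' ε hε).diff

/-- A Fourier multiplier series with `C¹`-holomorphic coefficients is `C¹`-holomorphic. -/
theorem C1HolBound.multiplier (hr : 0 < r) (hA : 0 ≤ A) (h : C1HolBound K (SD r ρ) U G A)
    (hU : ∀ q ∈ K, SliceHol r ρ (U q)) (hG : ∀ q ∈ K, SliceHol r ρ (G q))
    {c c' : ℤ → ℂ → ℂ} {L : ℤ → ℝ} (hL : ∀ k, 0 ≤ L k)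
    (hc : ∀ k, C1HolBound K (SD r' ρ) (fun q _ => c k q) (fun q _ => c' k q) (L k))
    (hs : Summable fun k : ℤ => L k * Real.exp (-(2 * Real.pi * |(k : ℝ)| * (r - r')))) :
    ∃ G' : ℂ → ℂ × ℂ → ℂ,
      C1HolBound K (SD r' ρ) (fun q a => ∑' k, c k q * _root_.fourierTerm k (U q) a) G'
        (4 * A * ∑' k : ℤ, L k * Real.exp (-(2 * Real.pi * |(k : ℝ)| * (r - r')))) := by
  have H := fun k => (hc k).mul (h.fourierTerm hr hU hG k (r' := r')) (hL k) (by positivity)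
  have e : (fun k : ℤ => 4 * (L k * (Real.exp (-(2 * Real.pi * |(k : ℝ)| * (r - r'))) * A))) =
      fun k : ℤ => 4 * A * (L k * Real.exp (-(2 * Real.pi * |(k : ℝ)| * (r - r')))) := by
    ext k; ring
  refine ⟨_, (C1HolBound.tsum (e ▸ hs.mul_left (4 * A)) H).mono ?_⟩
  rw [e, tsum_mul_left]

end Slice

theorem one_le_zetaR {s : ℝ} (hs : 1 < s) : 1 ≤ zetaR s := by
  have h := (summable_nat_add_iff (f := fun n : ℕ => 1 / (n : ℝ) ^ s) 1).2
    (Real.summable_one_div_nat_rpow.2 hs)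
  have := h.le_tsum 0 (fun n _ => by positivity)
  simpa [zetaR] using this

theorem Efn_eq_ek (ω : ℂ) : Efn ω = ek 1 ω := by simp [Efn, ek]

theorem Efn_ne_zero (ω : ℂ) : Efn ω ≠ 0 := Complex.exp_ne_zero _

theorem Efn_pow (ω : ℂ) (n : ℕ) : Efn ω ^ n = Efn (n * ω) := by
  rw [Efn, Efn, ← Complex.exp_nat_mul]; ring_nf

theorem Efn_neg (ω : ℂ) : Efn (-ω) = (Efn ω)⁻¹ := by
  rw [Efn, Efn, ← Complex.exp_neg]; ring_nf

theorem norm_Efn (ω : ℂ) : ‖Efn ω‖ = Real.exp (-(2 * Real.pi * ω.im)) := by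
  rw [Efn_eq_ek, norm_ek]; simp

theorem four_mul_abs_sub_round_le (x : ℝ) : 4 * |x - round x| ≤ ‖Efn x - 1‖ := by
  have h1 : Efn x = Complex.exp (I * ((2 * Real.pi * (x - round x) : ℝ) : ℂ)) := by
    rw [Efn, Complex.exp_eq_exp_iff_exists_int]
    exact ⟨round x, by push_cast; ring⟩
  have hx := abs_sub_round x
  have hpi := Real.pi_pos
  rw [h1, Complex.norm_exp_I_mul_ofReal_sub_one, norm_mul, Real.norm_eq_abs, Real.norm_eq_abs,
    abs_two]
  have h2 : 2 * Real.pi * (x - round x) / 2 = Real.pi * (x - round x) := by ring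
  rw [h2]
  have h3 := Real.mul_abs_le_abs_sin (x := Real.pi * (x - round x)) (by
    rw [abs_mul, abs_of_pos hpi]; nlinarith)
  rw [abs_mul, abs_of_pos hpi] at h3
  have h4 : 2 / Real.pi * (Real.pi * |x - round x|) = 2 * |x - round x| := by field_simp
  linarith

theorem half_le_norm_Efn_sub_one {z : ℂ} (hz : 0 ≤ z.im) {δ : ℝ} (hδ : 0 ≤ δ) (hδ1 : δ ≤ 1)
    (h : δ ≤ |z.re - round z.re| + |z.im|) : δ / 2 ≤ ‖Efn z - 1‖ := by
  have hn := norm_Efn z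
  have h1 : 1 - ‖Efn z‖ ≤ ‖Efn z - 1‖ := by
    rw [norm_sub_rev]; simpa using norm_sub_norm_le (1 : ℂ) (Efn z)
  rw [abs_of_nonneg hz] at h
  by_cases hx : δ / 2 ≤ |z.re - round z.re|
  · have hpolar : Efn z = Efn z.re * ‖Efn z‖ := by
      rw [hn, Efn, Efn, Complex.ofReal_exp, ← Complex.exp_add]
      congr 1
      conv_lhs => rw [← re_add_im z]
      push_cast
      linear_combination (2 * Real.pi * (z.im : ℂ)) * I_sq
    have hu : ‖Efn z.re‖ = 1 := by rw [norm_Efn]; simp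
    have h0 : ‖Efn z‖ ≤ 1 := by
      rw [hn, Real.exp_le_one_iff]; nlinarith [Real.pi_pos]
    have h2 : ‖Efn z.re - Efn z‖ = 1 - ‖Efn z‖ := by
      rw [hpolar, ← mul_one_sub, norm_mul, hu, one_mul, ← ofReal_one, ← ofReal_sub,
        Complex.norm_real, ← hpolar, Real.norm_eq_abs, abs_of_nonneg (by linarith)]
    have h3 : ‖Efn z.re - 1‖ ≤ ‖Efn z.re - Efn z‖ + ‖Efn z - 1‖ := norm_sub_le_norm_sub_add_norm_sub _ _ _
    have h4 := four_mul_abs_sub_round_le z.re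
    linarith
  · have hy : δ / 2 ≤ z.im := by linarith
    have h5 : Real.exp (-(2 * Real.pi * z.im)) ≤ 1 - δ / 2 := by
      have e1 : 3 * δ ≤ 2 * Real.pi * z.im := by nlinarith [Real.pi_gt_three]
      have e2 := Real.add_one_le_exp (2 * Real.pi * z.im)
      rw [Real.exp_neg, inv_le_comm₀ (Real.exp_pos _) (by linarith)]
      refine le_trans ?_ (le_trans (by linarith : 1 + 3 * δ ≤ 2 * Real.pi * z.im + 1) e2)
      rw [inv_le_iff_one_le_mul₀ (by linarith)]
      nlinarith
    linarith

theorem AMC_neg {τ M : ℝ} {ω : ℂ} (h : ω ∈ AMC τ M) : -ω ∈ AMC τ M := by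
  obtain ⟨ω₀, h0, h1⟩ := h
  refine ⟨-ω₀, fun n m hm => ?_, ?_⟩
  · have := h0 (-n) m hm
    rw [← abs_neg]
    convert this using 2
    push_cast; ring
  · rw [neg_re, neg_im, abs_neg, ← abs_neg]
    convert h1 using 2
    ring

theorem one_le_mul_norm_Efn_pow_sub_one {τ M : ℝ} (hτ : 0 < τ) (hM : 1 ≤ M) {ω : ℂ}
    (hω : ω ∈ AMC τ M) (him : 0 ≤ ω.im) {n : ℕ} (hn : 0 < n) :
    1 ≤ 2 * M * (n : ℝ) ^ (1 + τ) * ‖Efn ω ^ n - 1‖ := by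
  obtain ⟨ω₀, h0, h1⟩ := hω
  have hn1 : (1 : ℝ) ≤ n := by exact_mod_cast hn
  have hnp : (1 : ℝ) ≤ (n : ℝ) ^ (1 + τ) := Real.one_le_rpow hn1 (by linarith)
  have hM' : 1 ≤ M * (n : ℝ) ^ (1 + τ) := by nlinarith
  have key : 1 / (M * (n : ℝ) ^ (1 + τ)) ≤ |n * ω₀ - round (n * ω.re)| := by
    have := h0 (round (n * ω.re)) n hn
    have e : (n : ℝ) ^ (2 + τ) = n * (n : ℝ) ^ (1 + τ) := by
      rw [← Real.rpow_one_add' (by positivity) (by linarith)]; ring_nf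
    have e2 : |n * ω₀ - round (n * ω.re)| = n * |ω₀ - round (n * ω.re) / n| := by
      rw [← abs_of_nonneg (by positivity : (0 : ℝ) ≤ n), ← abs_mul,
        abs_of_nonneg (by positivity : (0 : ℝ) ≤ n)]
      congr 1; field_simp
    rw [e2]
    calc 1 / (M * (n : ℝ) ^ (1 + τ)) = n * (1 / (M * (n : ℝ) ^ (2 + τ))) := by
          rw [e]; field_simp
      _ ≤ _ := by gcongr
  have hz := half_le_norm_Efn_sub_one (z := n * ω) (δ := 1 / (M * (n : ℝ) ^ (1 + τ)))
    (by simpa using mul_nonneg (by positivity) him) (by positivity)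
    (by rw [div_le_one (by positivity)]; exact hM') (by
      simp only [mul_re, natCast_re, natCast_im, zero_mul, sub_zero, mul_im, add_zero]
      refine key.trans ?_
      have e3 : (n : ℝ) * ω₀ - round (n * ω.re) = (n * ω.re - round (n * ω.re)) + n * (ω₀ - ω.re) := by
        ring
      rw [e3]
      refine (abs_add_le _ _).trans ?_
      rw [abs_mul, abs_mul (n : ℝ)]
      gcongr)
  rw [Efn_pow]
  rw [div_div, div_le_iff₀ (by positivity)] at hz
  linarith

theorem mem_finPart_KM {τ M : ℝ} {q : ℂ} :
    q ∈ finPart (KM τ M) ↔ q = 0 ∨ ∃ ω ∈ AMC τ M, Efn ω = q := by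
  simp only [finPart, KM, mem_ofPred_eq, mem_union, mem_image, mem_insert_iff, mem_singleton_iff,
    OnePoint.coe_eq_coe, OnePoint.coe_ne_infty, or_false]
  exact or_comm

theorem infPart_KM (τ M : ℝ) : infPart (KM τ M) = finPart (KM τ M) := by
  ext ξ
  by_cases h : ξ = 0
  · subst h
    simp [infPart, finPart, sphChart, KM]
  · have : ξ ∈ infPart (KM τ M) ↔ ξ⁻¹ ∈ finPart (KM τ M) := by
      simp [infPart, finPart, sphChart, h]
    rw [this, mem_finPart_KM, mem_finPart_KM]
    simp only [inv_eq_zero, h, false_or]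
    constructor
    · rintro ⟨ω, hω, he⟩
      exact ⟨-ω, AMC_neg hω, by rw [Efn_neg, he, inv_inv]⟩
    · rintro ⟨ω, hω, he⟩
      exact ⟨-ω, AMC_neg hω, by rw [Efn_neg, he]⟩

section Lam

variable {τ M : ℝ}

theorem pow_ne_one_and_norm_mul_le (hτ : 0 < τ) (hM : 1 ≤ M) {n : ℕ} (hn : 0 < n) {q : ℂ}
    (hq : q ∈ finPart (KM τ M)) :
    q ^ n ≠ 1 ∧ ∀ j ≤ n, ‖q‖ ^ j * ‖(q ^ n - 1)⁻¹‖ ≤ 2 * M * (n : ℝ) ^ (1 + τ) := by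
  have hn1 : (1 : ℝ) ≤ n := by exact_mod_cast hn
  have hnp : (1 : ℝ) ≤ (n : ℝ) ^ (1 + τ) := Real.one_le_rpow hn1 (by linarith)
  have hM' : 1 ≤ M * (n : ℝ) ^ (1 + τ) := by nlinarith
  suffices H : 1 ≤ 2 * M * (n : ℝ) ^ (1 + τ) * ‖q ^ n - 1‖ ∧
      ‖q‖ ^ n ≤ 2 * M * (n : ℝ) ^ (1 + τ) * ‖q ^ n - 1‖ by
    have hne : q ^ n ≠ 1 := fun h => by
      have := H.1
      rw [h, sub_self, norm_zero, mul_zero] at this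
      linarith
    have hpos : 0 < ‖q ^ n - 1‖ := norm_pos_iff.2 (sub_ne_zero.2 hne)
    refine ⟨hne, fun j hj => ?_⟩
    rw [norm_inv, ← div_eq_mul_inv, div_le_iff₀ hpos]
    rcases le_total ‖q‖ 1 with h | h
    · exact (pow_le_one₀ (norm_nonneg _) h).trans H.1
    · exact (pow_le_pow_right₀ h hj).trans H.2
  rcases mem_finPart_KM.1 hq with rfl | ⟨ω, hω, rfl⟩
  · simp only [ne_eq, hn.ne', not_false_eq_true, zero_pow, zero_sub, norm_neg, norm_one, mul_one,
      norm_zero]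
    constructor <;> linarith
  · rcases le_total 0 ω.im with him | him
    · have h := one_le_mul_norm_Efn_pow_sub_one hτ hM hω him hn
      refine ⟨h, le_trans (pow_le_one₀ (norm_nonneg _) ?_) h⟩
      rw [norm_Efn, Real.exp_le_one_iff]; nlinarith [Real.pi_pos]
    · have h := one_le_mul_norm_Efn_pow_sub_one hτ hM (AMC_neg hω) (by simpa using him) hn
      have h1 : 1 ≤ ‖Efn ω‖ := by
        rw [norm_Efn, Real.one_le_exp_iff]; nlinarith [Real.pi_pos]
      have hE := Efn_ne_zero ω
      have h2 : ‖Efn (-ω) ^ n - 1‖ * ‖Efn ω‖ ^ n = ‖Efn ω ^ n - 1‖ := by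
        rw [← norm_pow, ← norm_mul, Efn_neg, sub_mul, inv_pow, inv_mul_cancel₀ (pow_ne_zero _ hE),
          one_mul, norm_sub_rev]
      have h3 : ‖Efn ω‖ ^ n ≤ 2 * M * (n : ℝ) ^ (1 + τ) * ‖Efn ω ^ n - 1‖ := by
        rw [← h2, ← mul_assoc]
        exact le_mul_of_one_le_left (by positivity) h
      exact ⟨(one_le_pow₀ h1).trans h3, h3⟩

theorem omegaF_inv_pow_sub_one {α : Type*} {n : ℕ} {p : ℂ × ℂ} (h1 : p.1 ^ n ≠ 1)
    (h2 : p.2 ^ n ≠ 1) (a : α) :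
    omegaF (fun q (_ : α) => (q ^ n - 1)⁻¹)
        (fun q _ => -(n * q ^ (n - 1) * ((q ^ n - 1)⁻¹ * (q ^ n - 1)⁻¹))) p a =
      n * p.1 ^ (n - 1) * ((p.1 ^ n - 1)⁻¹ * (p.1 ^ n - 1)⁻¹) -
        ∑ i ∈ Finset.range n, p.2 ^ i * (p.2 ^ n - 1)⁻¹ * (p.1 ^ (n - 1 - i) * (p.1 ^ n - 1)⁻¹) := by
  have e : ∑ i ∈ Finset.range n, p.2 ^ i * (p.2 ^ n - 1)⁻¹ * (p.1 ^ (n - 1 - i) * (p.1 ^ n - 1)⁻¹)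
      = (∑ i ∈ Finset.range n, p.2 ^ i * p.1 ^ (n - 1 - i)) *
        ((p.2 ^ n - 1)⁻¹ * (p.1 ^ n - 1)⁻¹) := by
    rw [Finset.sum_mul]
    exact Finset.sum_congr rfl fun i _ => by ring
  rw [e]
  by_cases h : p.1 = p.2
  · have hg : ∑ i ∈ Finset.range n, p.2 ^ i * p.2 ^ (n - 1 - i) = n * p.2 ^ (n - 1) := by
      rw [Finset.sum_congr rfl (g := fun _ => p.2 ^ (n - 1)), Finset.sum_const, Finset.card_range,
        nsmul_eq_mul]
      intro i hi
      rw [← pow_add]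
      congr 1
      have := Finset.mem_range.1 hi
      omega
    simp only [omegaF, h, if_true, hg]
    ring
  · have hd : p.2 - p.1 ≠ 0 := sub_ne_zero.2 (Ne.symm h)
    have hg := (Commute.all p.2 p.1).geom_sum₂_mul n
    have h1' : p.1 ^ n - 1 ≠ 0 := sub_ne_zero.2 h1
    have h2' : p.2 ^ n - 1 ≠ 0 := sub_ne_zero.2 h2
    have hdiff : (p.2 ^ n - 1)⁻¹ - (p.1 ^ n - 1)⁻¹ =
        -((p.2 ^ n - p.1 ^ n) * ((p.2 ^ n - 1)⁻¹ * (p.1 ^ n - 1)⁻¹)) := by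
      field_simp
      ring
    simp only [omegaF, h, if_false, smul_eq_mul, hdiff, ← hg]
    field_simp
    ring

theorem c1HolBound_inv_pow_sub_one {α : Type*} (S : Set α) (hτ : 0 < τ) (hM : 1 ≤ M) {n : ℕ}
    (hn : 0 < n) :
    C1HolBound (finPart (KM τ M)) S (fun q _ => (q ^ n - 1)⁻¹)
      (fun q _ => -(n * q ^ (n - 1) * ((q ^ n - 1)⁻¹ * (q ^ n - 1)⁻¹)))
      (8 * M ^ 2 * (n : ℝ) ^ (3 + 2 * τ)) := by
  set K := finPart (KM τ M)
  set Λ := 2 * M * (n : ℝ) ^ (1 + τ)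
  have hn1 : (1 : ℝ) ≤ n := by exact_mod_cast hn
  have hnp : (1 : ℝ) ≤ (n : ℝ) ^ (1 + τ) := Real.one_le_rpow hn1 (by linarith)
  have hΛ : 1 ≤ Λ := by simp only [Λ]; nlinarith
  have hL : 8 * M ^ 2 * (n : ℝ) ^ (3 + 2 * τ) = 2 * (n * Λ ^ 2) := by
    have : (n : ℝ) ^ (3 + 2 * τ) = n * ((n : ℝ) ^ (1 + τ)) ^ 2 := by
      rw [← Real.rpow_natCast, ← Real.rpow_mul (by positivity),
        ← Real.rpow_one_add' (by positivity) (by push_cast; nlinarith)]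
      push_cast; ring_nf
    rw [this]; simp only [Λ]; ring
  rw [hL]
  have hq := fun (q : ℂ) (h : q ∈ K) => pow_ne_one_and_norm_mul_le hτ hM hn h
  have hcl : ContinuousOn (fun q : ℂ => (q ^ n - 1)⁻¹) K :=
    ContinuousOn.inv₀ (by fun_prop) fun q h => sub_ne_zero.2 (hq q h).1
  have hcl1 : ContinuousOn (fun p : ℂ × ℂ => (p.1 ^ n - 1)⁻¹) (K ×ˢ K) :=
    hcl.comp continuousOn_fst fun _ h => h.1
  have hcl2 : ContinuousOn (fun p : ℂ × ℂ => (p.2 ^ n - 1)⁻¹) (K ×ˢ K) :=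
    hcl.comp continuousOn_snd fun _ h => h.2
  have hb0 : ∀ q ∈ K, ‖(q ^ n - 1)⁻¹‖ ≤ Λ := fun q h => by simpa using (hq q h).2 0 (by omega)
  have hder : ∀ q ∈ K, ‖(n : ℂ) * q ^ (n - 1) * ((q ^ n - 1)⁻¹ * (q ^ n - 1)⁻¹)‖ ≤ n * Λ ^ 2 := by
    intro q h
    have e1 := (hq q h).2 (n - 1) (by omega)
    calc _ = n * ((‖q‖ ^ (n - 1) * ‖(q ^ n - 1)⁻¹‖) * ‖(q ^ n - 1)⁻¹‖) := by
          simp only [norm_mul, norm_pow, Complex.norm_natCast]; ring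
      _ ≤ n * (Λ * Λ) := by
          gcongr
          exact hb0 q h
      _ = _ := by ring
  refine ⟨.of_continuousOn hcl, .of_continuousOn ?_, ?_, fun q h a _ => (hb0 q h).trans ?_,
    fun q h a _ => ?_, fun p h a _ => ?_⟩
  · fun_prop
  · refine (SupContinuousOn.of_continuousOn (c := fun p : ℂ × ℂ => n * p.1 ^ (n - 1) *
      ((p.1 ^ n - 1)⁻¹ * (p.1 ^ n - 1)⁻¹) - ∑ i ∈ Finset.range n, p.2 ^ i * (p.2 ^ n - 1)⁻¹ *
        (p.1 ^ (n - 1 - i) * (p.1 ^ n - 1)⁻¹)) ?_).congr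
      fun p h a _ => omegaF_inv_pow_sub_one (hq _ h.1).1 (hq _ h.2).1 a
    fun_prop
  · nlinarith
  · rw [norm_neg]
    refine (hder q h).trans ?_
    have : 0 ≤ n * Λ ^ 2 := by positivity
    linarith
  · rw [omegaF_inv_pow_sub_one (hq _ h.1).1 (hq _ h.2).1 a]
    have hsum : ‖∑ i ∈ Finset.range n, p.2 ^ i * (p.2 ^ n - 1)⁻¹ *
        (p.1 ^ (n - 1 - i) * (p.1 ^ n - 1)⁻¹)‖ ≤ n * Λ ^ 2 := by
      refine (norm_sum_le_of_le (n := fun _ => Λ ^ 2) _ fun i hi => ?_).trans_eq (by simp)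
      have hi := Finset.mem_range.1 hi
      have e1 := (hq _ h.1).2 (n - 1 - i) (by omega)
      have e2 := (hq _ h.2).2 i (by omega)
      simp only [norm_mul, norm_pow]
      rw [pow_two]
      gcongr
    refine (norm_sub_le _ _).trans ((add_le_add (hder _ h.1) hsum).trans_eq (by ring))

theorem C1HolBound.const_mul {α : Type*} {K : Set ℂ} {S : Set α} {u g : ℂ → α → ℂ} {A : ℝ}
    (h : C1HolBound K S u g A) (b : ℂ) :
    C1HolBound K S (fun q a => b * u q a) (fun q a => b * g q a) (‖b‖ * A) := by
  have hΩ : ∀ p a, omegaF (fun q a => b * u q a) (fun q a => b * g q a) p a = b * omegaF u g p a := by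
    intro p a
    simp only [omegaF, smul_eq_mul]
    split_ifs <;> ring
  have hb {X : Type} [PseudoMetricSpace X] (T : Set X) : SupContinuousOn T S fun _ _ => b :=
    .of_continuousOn (c := fun _ => b) continuousOn_const
  refine ⟨(hb K).mul h.cont (fun _ _ _ _ => le_rfl) h.bound,
    (hb K).mul h.cont_deriv (fun _ _ _ _ => le_rfl) h.bound_deriv,
    ((hb (K ×ˢ K)).mul h.cont_omega (fun _ _ _ _ => le_rfl) h.bound_omega).congr
      fun p _ a _ => hΩ p a, fun q hq a ha => ?_, fun q hq a ha => ?_, fun q hq a ha => ?_⟩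
  · rw [norm_mul]; gcongr; exact h.bound q hq a ha
  · rw [norm_mul]; gcongr; exact h.bound_deriv q hq a ha
  · rw [hΩ, norm_mul]; gcongr; exact h.bound_omega q hq a ha

theorem lamk_natCast {n : ℕ} (hn : 0 < n) (q : ℂ) : lamk n (q : OnePoint ℂ) = (q ^ n - 1)⁻¹ := by
  have hn' : (0 : ℤ) < n := by exact_mod_cast hn
  change (if q = 0 then (if (0 : ℤ) < n then (-1 : ℂ) else 0) else (q ^ (n : ℤ) - 1)⁻¹) = _
  split_ifs with h
  · simp [h, hn.ne']
  · rw [zpow_natCast]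

theorem lamk_coe {k : ℤ} {q : ℂ} (hq : q ≠ 0) : lamk k (q : OnePoint ℂ) = (q ^ k - 1)⁻¹ := by
  change (if q = 0 then _ else (q ^ k - 1)⁻¹) = _
  rw [if_neg hq]

theorem lamk_neg_add {k : ℤ} (hk : k ≠ 0) {q : ℂ} (h : q = 0 ∨ q ^ k ≠ 1) :
    lamk (-k) (q : OnePoint ℂ) = -1 - lamk k q := by
  by_cases hq : q = 0
  · subst hq
    change (if (0 : ℂ) = 0 then (if 0 < -k then (-1 : ℂ) else 0) else _) =
      -1 - (if (0 : ℂ) = 0 then (if 0 < k then (-1 : ℂ) else 0) else _)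
    rcases lt_or_gt_of_ne hk with h | h
    · simp [h, not_lt.2 h.le]
    · simp [h, not_lt.2 h.le]
  · have h1 : q ^ k ≠ 1 := h.resolve_left hq
    have h0 : q ^ k ≠ 0 := zpow_ne_zero k hq
    have h2 : q ^ k - 1 ≠ 0 := sub_ne_zero.2 h1
    have h3 : 1 - q ^ k ≠ 0 := sub_ne_zero.2 h1.symm
    have h4 : (q ^ k)⁻¹ - 1 ≠ 0 := sub_ne_zero.2 fun h => h1 (inv_eq_one.1 h)
    rw [lamk_coe hq, lamk_coe hq, zpow_neg]
    field_simp
    ring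

theorem lamk_sphChart {k : ℤ} (hk : k ≠ 0) (ξ : ℂ) :
    lamk k (sphChart ξ) = lamk (-k) (ξ : OnePoint ℂ) := by
  by_cases h : ξ = 0
  · subst h
    rw [sphChart, if_pos rfl]
    change (if 0 < k then (0 : ℂ) else -1) =
      (if (0 : ℂ) = 0 then (if 0 < -k then (-1 : ℂ) else 0) else _)
    rcases lt_or_gt_of_ne hk with h | h
    · simp [h, h.le]
    · simp [h, h.le]
  · rw [sphChart, if_neg h, lamk_coe h, lamk_coe (inv_ne_zero h), zpow_neg, inv_zpow]

theorem pow_ne_one_of_mem (hτ : 0 < τ) (hM : 1 ≤ M) {k : ℤ} (hk : k ≠ 0) {q : ℂ}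
    (hq : q ∈ finPart (KM τ M)) : q = 0 ∨ q ^ k ≠ 1 := by
  have h := (pow_ne_one_and_norm_mul_le hτ hM (Int.natAbs_pos.2 hk) hq).1
  rcases Int.natAbs_eq k with e | e
  · right; rw [e, zpow_natCast]; exact h
  · right; rw [e, zpow_neg, zpow_natCast]; exact fun h' => h (inv_eq_one.1 h')

theorem exists_c1HolBound_lamk {α : Type*} (S : Set α) (hτ : 0 < τ) (hM : 1 ≤ M) {k : ℤ}
    (hk : k ≠ 0) : ∃ c' : ℂ → ℂ, C1HolBound (finPart (KM τ M)) S
      (fun q _ => lamk k (q : OnePoint ℂ)) (fun q _ => c' q)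
      (8 * M ^ 2 * |(k : ℝ)| ^ (3 + 2 * τ)) := by
  have hn : 0 < k.natAbs := Int.natAbs_pos.2 hk
  have hka : |(k : ℝ)| = (k.natAbs : ℝ) := by rw [Nat.cast_natAbs, Int.cast_abs]
  have H := c1HolBound_inv_pow_sub_one S hτ hM hn
  rw [hka]
  rcases Int.natAbs_eq k with e | e
  · refine ⟨_, H.congr fun q hq a _ => ?_⟩
    rw [e, lamk_natCast hn, Int.natAbs_natCast]
  · set n := k.natAbs
    have h1 : ∀ q ∈ finPart (KM τ M), lamk k (q : OnePoint ℂ) = -1 - (q ^ n - 1)⁻¹ := by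
      intro q hq
      rw [e, lamk_neg_add (by exact_mod_cast hn.ne') (pow_ne_one_of_mem hτ hM
        (by exact_mod_cast hn.ne') hq), lamk_natCast hn]
    have N := H.const_mul (-1)
    have hc : SupContinuousOn (finPart (KM τ M)) S fun _ _ => (-1 : ℂ) :=
      .of_continuousOn (c := fun _ => (-1 : ℂ)) continuousOn_const
    have hΩ : ∀ p ∈ finPart (KM τ M) ×ˢ finPart (KM τ M), ∀ a ∈ S,
        omegaF (fun q (_ : α) => -1 - (q ^ n - 1)⁻¹) (fun q _ => -1 *
          -(n * q ^ (n - 1) * ((q ^ n - 1)⁻¹ * (q ^ n - 1)⁻¹))) p a =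
        omegaF (fun q (_ : α) => -1 * (q ^ n - 1)⁻¹) (fun q _ => -1 *
          -(n * q ^ (n - 1) * ((q ^ n - 1)⁻¹ * (q ^ n - 1)⁻¹))) p a := by
      intro p _ a _
      simp only [omegaF, smul_eq_mul]
      split_ifs <;> ring
    rw [norm_neg, norm_one, one_mul] at N
    refine ⟨_, C1HolBound.congr (u := fun q _ => -1 - (q ^ n - 1)⁻¹) ⟨(hc.add N.cont).congr
      fun q _ a _ => by ring, N.cont_deriv, N.cont_omega.congr hΩ, fun q hq a ha => ?_,
      N.bound_deriv, fun p hp a ha => ?_⟩ fun q hq a _ => h1 q hq⟩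
    · obtain ⟨hne, hb⟩ := pow_ne_one_and_norm_mul_le hτ hM hn hq
      have e1 : -1 - (q ^ n - 1)⁻¹ = -(q ^ n * (q ^ n - 1)⁻¹) := by
        have := sub_ne_zero.2 hne
        field_simp
        ring
      rw [e1, norm_neg, norm_mul, norm_pow]
      refine (hb n le_rfl).trans ?_
      have hn1 : (1 : ℝ) ≤ n := by exact_mod_cast hn
      have : (n : ℝ) ^ (1 + τ) ≤ (n : ℝ) ^ (3 + 2 * τ) :=
        Real.rpow_le_rpow_of_exponent_le hn1 (by linarith)
      have h2 : 2 * M ≤ 8 * M ^ 2 := by nlinarith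
      gcongr
    · rw [hΩ p hp a ha]
      exact N.bound_omega p hp a ha

end Lam

theorem tsum_exp_neg_abs_le {y : ℝ} (hy : 0 < y) :
    Summable (fun k : ℤ => Real.exp (-(y * |(k : ℝ)|))) ∧
      ∑' k : ℤ, Real.exp (-(y * |(k : ℝ)|)) ≤ 2 * (1 + y) / y := by
  have hlt : Real.exp (-y) < 1 := by simpa using hy
  have h : HasSum (fun n : ℕ => Real.exp (-(y * n))) (1 - Real.exp (-y))⁻¹ := by
    refine (hasSum_geometric_of_lt_one (Real.exp_pos (-y)).le hlt).congr_fun fun n => ?_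
    rw [← Real.exp_nat_mul]; ring_nf
  have H : HasSum (fun k : ℤ => Real.exp (-(y * |(k : ℝ)|))) _ :=
    HasSum.of_nat_of_neg (by simpa using h) (by simpa using h)
  refine ⟨H.summable, ?_⟩
  rw [H.tsum_eq]
  have h1 : y / (1 + y) ≤ 1 - Real.exp (-y) := by
    rw [Real.exp_neg, div_le_iff₀ (by linarith)]
    have : (Real.exp y)⁻¹ * (1 + y) ≤ 1 := by
      rw [inv_mul_le_iff₀ (Real.exp_pos y)]
      linarith [Real.add_one_le_exp y]
    nlinarith
  have h2 : (1 - Real.exp (-y))⁻¹ ≤ (1 + y) / y := by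
    rw [← inv_div]; exact inv_anti₀ (by positivity) h1
  have h3 : 2 * (1 + y) / y = (1 + y) / y + (1 + y) / y := by ring
  rw [h3]
  exact (sub_le_self _ (Real.exp_pos _).le).trans (add_le_add h2 h2)

theorem exists_rpow_le_mul_exp {s : ℝ} (hs : 0 ≤ s) : ∃ C : ℝ, 0 < C ∧ ∀ x : ℝ, 0 ≤ x →
    x ^ s ≤ C * Real.exp x := by
  refine ⟨1 + (⌈s⌉₊).factorial, by positivity, fun x hx => ?_⟩
  rcases le_total x 1 with h | h
  · have h1 : x ^ s ≤ 1 := Real.rpow_le_one hx h hs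
    have h2 : 1 ≤ Real.exp x := Real.one_le_exp hx
    have : (1 : ℝ) ≤ 1 + (⌈s⌉₊).factorial := by simp
    nlinarith
  · have h1 : x ^ s ≤ x ^ ⌈s⌉₊ := by
      rw [← Real.rpow_natCast]
      exact Real.rpow_le_rpow_of_exponent_le h (Nat.le_ceil s)
    have h2 := Real.pow_div_factorial_le_exp x hx ⌈s⌉₊
    rw [div_le_iff₀ (by positivity)] at h2
    nlinarith [Real.exp_pos x]

/-- Sums of powers against exponential weights. -/
theorem exists_tsum_rpow_mul_exp_le {s : ℝ} (hs : 0 ≤ s) : ∃ C : ℝ, 0 < C ∧ ∀ d : ℝ, 0 < d →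
    Summable (fun k : ℤ => |(k : ℝ)| ^ s * Real.exp (-(2 * Real.pi * |(k : ℝ)| * d))) ∧
      (d ≤ 1 → ∑' k : ℤ, |(k : ℝ)| ^ s * Real.exp (-(2 * Real.pi * |(k : ℝ)| * d)) ≤
        C / d ^ (s + 1)) := by
  obtain ⟨C, hC, H⟩ := exists_rpow_le_mul_exp hs
  refine ⟨4 * C, by positivity, fun d hd => ?_⟩
  have hle : ∀ k : ℤ, |(k : ℝ)| ^ s * Real.exp (-(2 * Real.pi * |(k : ℝ)| * d)) ≤
      C / d ^ s * Real.exp (-(d * |(k : ℝ)|)) := by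
    intro k
    have h1 := H (d * |(k : ℝ)|) (by positivity)
    rw [Real.mul_rpow hd.le (abs_nonneg _), mul_comm, ← le_div_iff₀ (by positivity)] at h1
    have h2 : Real.exp (-(2 * Real.pi * |(k : ℝ)| * d)) ≤
        Real.exp (-(d * |(k : ℝ)|)) * Real.exp (-(d * |(k : ℝ)|)) := by
      rw [← Real.exp_add, Real.exp_le_exp]
      have : 0 ≤ |(k : ℝ)| * d := by positivity
      nlinarith [Real.pi_gt_three]
    calc _ ≤ C * Real.exp (d * |(k : ℝ)|) / d ^ s *
          (Real.exp (-(d * |(k : ℝ)|)) * Real.exp (-(d * |(k : ℝ)|))) := by gcongr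
      _ = _ := by
        rw [Real.exp_neg]
        field_simp
  obtain ⟨hs1, hs2⟩ := tsum_exp_neg_abs_le hd
  have hsum := Summable.of_nonneg_of_le (fun k => by positivity) hle (hs1.mul_left _)
  refine ⟨hsum, fun hd1 => ?_⟩
  calc _ ≤ ∑' k : ℤ, C / d ^ s * Real.exp (-(d * |(k : ℝ)|)) :=
        hsum.tsum_le_tsum hle (hs1.mul_left _)
    _ ≤ C / d ^ s * (4 / d) := by
        rw [tsum_mul_left]
        gcongr
        refine hs2.trans ?_
        gcongr
        linarith
    _ = _ := by
        rw [Real.rpow_add hd, Real.rpow_one]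
        field_simp

section Perfect

variable {τ M : ℝ}

theorem AMC_add_mul_I {ω : ℂ} (h : ω ∈ AMC τ M) {t : ℝ} (ht : 0 ≤ t * ω.im) :
    ω + t * I ∈ AMC τ M := by
  obtain ⟨ω₀, h0, h1⟩ := h
  refine ⟨ω₀, h0, ?_⟩
  have e : (ω + t * I).re = ω.re := by simp
  have e' : (ω + t * I).im = ω.im + t := by simp
  rw [e, e']
  refine h1.trans (sq_le_sq.1 ?_)
  nlinarith [sq_nonneg t]

theorem accPt_finPart_KM (hne : (AMC τ M).Nonempty) {q : ℂ} (hq : q ∈ finPart (KM τ M)) :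
    (𝓝[finPart (KM τ M) \ {q}] q).NeBot := by
  have hK : ∀ ω ∈ AMC τ M, Efn ω ∈ finPart (KM τ M) := fun ω h => mem_finPart_KM.2 (.inr ⟨ω, h, rfl⟩)
  rcases mem_finPart_KM.1 hq with rfl | ⟨ω, hω, rfl⟩
  · obtain ⟨ω, hω, him⟩ : ∃ ω ∈ AMC τ M, 0 ≤ ω.im := by
      obtain ⟨ω, hω⟩ := hne
      rcases le_total 0 ω.im with h | h
      · exact ⟨ω, hω, h⟩
      · exact ⟨-ω, AMC_neg hω, by simpa using h⟩
    have hlim : Tendsto (fun t : ℝ => Efn (ω + t * I)) atTop (𝓝 0) := by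
      rw [tendsto_zero_iff_norm_tendsto_zero]
      simp only [norm_Efn, add_im, mul_im, ofReal_re, I_im, mul_one, ofReal_im, I_re, mul_zero,
        add_zero]
      refine Real.tendsto_exp_neg_atTop_nhds_zero.comp ?_
      exact (tendsto_atTop_add_const_left _ _ tendsto_id).const_mul_atTop Real.two_pi_pos
    refine (tendsto_nhdsWithin_iff.2 ⟨hlim, ?_⟩).neBot
    filter_upwards [eventually_ge_atTop 0] with t ht
    exact ⟨hK _ (AMC_add_mul_I hω (mul_nonneg ht him)), Efn_ne_zero _⟩
  · obtain ⟨s, hs, hs0⟩ : ∃ s : ℝ, 0 ≤ s * ω.im ∧ s ≠ 0 := by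
      rcases le_total 0 ω.im with h | h
      · exact ⟨1, by simpa using h, one_ne_zero⟩
      · exact ⟨-1, by simpa using h, by norm_num⟩
    have hlim : Tendsto (fun t : ℝ => Efn (ω + ((t * s : ℝ) : ℂ) * I)) (𝓝[>] 0) (𝓝 (Efn ω)) := by
      have hc : Continuous fun t : ℝ => Efn (ω + ((t * s : ℝ) : ℂ) * I) := by
        unfold Efn; fun_prop
      simpa using (hc.tendsto 0).mono_left nhdsWithin_le_nhds
    refine (tendsto_nhdsWithin_iff.2 ⟨hlim, ?_⟩).neBot
    filter_upwards [self_mem_nhdsWithin] with t ht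
    have ht : 0 < t := ht
    refine ⟨hK _ (AMC_add_mul_I hω (by rw [mul_assoc]; positivity)), fun h => ?_⟩
    have h : Efn (ω + ((t * s : ℝ) : ℂ) * I) = Efn ω := h
    have := congrArg norm h
    simp only [norm_Efn, Real.exp_eq_exp, add_im, mul_im, ofReal_re, I_im, mul_one, ofReal_im,
      I_re, mul_zero, add_zero] at this
    have : t * s = 0 := by nlinarith [Real.pi_pos]
    exact (mul_ne_zero ht.ne' hs0) this

theorem C1HolBound.of_subsingleton {α : Type*} {K : Set ℂ} {S : Set α} {u g : ℂ → α → ℂ} {A : ℝ}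
    (hA : 0 ≤ A) (hK : K.Subsingleton) (h : C1HolBound K S u g A) :
    C1HolBound K S u (fun _ _ => 0) A where
  cont := h.cont
  cont_deriv := .of_continuousOn continuousOn_const
  cont_omega := by
    intro p hp ε hε
    refine ⟨1, one_pos, fun p' hp' _ a _ => ?_⟩
    rw [Prod.ext (hK hp'.1 hp.1) (hK hp'.2 hp.2), sub_self, norm_zero]
    exact hε.le
  bound := h.bound
  bound_deriv := fun _ _ _ _ => by simpa using hA
  bound_omega := fun p hp a _ => by simpa [omegaF, hK hp.1 hp.2] using hA

/-- The derivative data of a `C¹`-holomorphic function on `K_M` may be taken holomorphic and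
periodic in `θ`. -/
theorem C1HolBound.exists_sliceHol_deriv {r ρ A : ℝ} {U G : ℂ → ℂ × ℂ → ℂ} (hA : 0 ≤ A)
    (h : C1HolBound (finPart (KM τ M)) (SD r ρ) U G A)
    (hU : ∀ q ∈ finPart (KM τ M), SliceHol r ρ (U q)) :
    ∃ G', C1HolBound (finPart (KM τ M)) (SD r ρ) U G' A ∧
      ∀ q ∈ finPart (KM τ M), SliceHol r ρ (G' q) := by
  rcases (AMC τ M).eq_empty_or_nonempty with he | hne
  · refine ⟨_, h.of_subsingleton hA fun q hq q' hq' => ?_, fun q _ => sliceHol_zero⟩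
    have : ∀ q ∈ finPart (KM τ M), q = 0 := fun q hq => by simpa [he] using mem_finPart_KM.1 hq
    rw [this q hq, this q' hq']
  · exact ⟨G, h, fun q hq => h.sliceHol_deriv hU hq (accPt_finPart_KM hne hq)⟩

end Perfect

section Multiplier

variable {τ M r r' ρ : ℝ} {u F : OnePoint ℂ → ℂ × ℂ → ℂ} {g h : ℂ → ℂ × ℂ → ℂ}

theorem CNorm_nonneg (τ M r ρ : ℝ) (u : OnePoint ℂ → ℂ × ℂ → ℂ) (g h : ℂ → ℂ × ℂ → ℂ) :
    0 ≤ CNorm τ M r ρ u g h :=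
  (fNorm_nonneg _ _ _ _).trans (le_max_left _ _)

theorem zero_mem_finPart_KM : (0 : ℂ) ∈ finPart (KM τ M) := mem_finPart_KM.2 (.inl rfl)

theorem sphChart_zero : sphChart 0 = ∞ := if_pos rfl

theorem MemC.c1HolBound (hu : MemC τ M r ρ u g h) :
    C1HolBound (finPart (KM τ M)) (SD r ρ) (fun q : ℂ => u q) g (CNorm τ M r ρ u g h) :=
  (C1HolBound.of_fPair hu.1.1 hu.2.1.1).mono (le_max_left _ _)

theorem MemC.c1HolBound_sphChart (hu : MemC τ M r ρ u g h) :
    C1HolBound (finPart (KM τ M)) (SD r ρ) (fun ξ : ℂ => u (sphChart ξ)) h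
      (CNorm τ M r ρ u g h) := by
  rw [← infPart_KM]
  exact (C1HolBound.of_fPair hu.1.2 hu.2.1.2).mono (le_max_right _ _)

theorem sphChart_mem {ξ : ℂ} (hξ : ξ ∈ finPart (KM τ M)) : sphChart ξ ∈ KM τ M := by
  rw [← infPart_KM] at hξ
  exact hξ

theorem MemC.of_c1HolBound {A : ℝ} (hA : 0 ≤ A)
    (h1 : C1HolBound (finPart (KM τ M)) (SD r ρ) (fun q : ℂ => F q) g A)
    (h2 : C1HolBound (finPart (KM τ M)) (SD r ρ) (fun ξ : ℂ => F (sphChart ξ)) h A)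
    (hF : ∀ q ∈ KM τ M, ValHol r ρ (F q)) :
    MemC τ M r ρ F g h ∧ CNorm τ M r ρ F g h ≤ 4 * A := by
  have h2' := h2
  rw [← infPart_KM] at h2'
  exact ⟨⟨⟨h1.fPair, h2'.fPair⟩, ⟨h1.fBdd, h2'.fBdd⟩, hF⟩,
    max_le (h1.fNorm_le hA) (h2'.fNorm_le hA)⟩

theorem MemC.norm_le (hu : MemC τ M r ρ u g h) {q : OnePoint ℂ} (hq : q ∈ KM τ M) {p : ℂ × ℂ}
    (hp : p ∈ SD r ρ) : ‖u q p‖ ≤ CNorm τ M r ρ u g h := by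
  induction q using OnePoint.rec with
  | infty =>
    rw [← sphChart_zero]
    exact hu.c1HolBound_sphChart.bound 0 zero_mem_finPart_KM p hp
  | coe z => exact hu.c1HolBound.bound z hq p hp

/-- Families of multipliers `c_k` on `K_M` that are `C¹`-holomorphic with bounds `L_k`. -/
structure SphereMultiplier (τ M : ℝ) (S : Set (ℂ × ℂ)) (c : ℤ → OnePoint ℂ → ℂ) (L : ℤ → ℝ) :
    Prop where
  nonneg : ∀ k, 0 ≤ L k
  fin : ∀ k, ∃ c' : ℂ → ℂ,
    C1HolBound (finPart (KM τ M)) S (fun q _ => c k (q : OnePoint ℂ)) (fun q _ => c' q) (L k)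
  inf : ∀ k, ∃ c' : ℂ → ℂ,
    C1HolBound (finPart (KM τ M)) S (fun ξ _ => c k (sphChart ξ)) (fun ξ _ => c' ξ) (L k)

variable {S : Set (ℂ × ℂ)} {c : ℤ → OnePoint ℂ → ℂ} {L : ℤ → ℝ}

theorem SphereMultiplier.norm_le (hc : SphereMultiplier τ M S c L) (hS : S.Nonempty) (k : ℤ)
    {q : OnePoint ℂ} (hq : q ∈ KM τ M) : ‖c k q‖ ≤ L k := by
  obtain ⟨p, hp⟩ := hS
  induction q using OnePoint.rec with
  | infty =>
    obtain ⟨c', h⟩ := hc.inf k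
    rw [← sphChart_zero]
    exact h.bound 0 zero_mem_finPart_KM p hp
  | coe z =>
    obtain ⟨c', h⟩ := hc.fin k
    exact h.bound z hq p hp

/-- The weighted sum of the multiplier bounds that controls the multiplier series. -/
def multiplierSum (L : ℤ → ℝ) (d : ℝ) : ℝ :=
  ∑' k : ℤ, L k * Real.exp (-(2 * Real.pi * |(k : ℝ)| * d))

variable (hu : MemC τ M r ρ u g h) (hr' : 0 < r') (hr : r' < r)
  (hc : SphereMultiplier τ M (SD r' ρ) c L)
  (hs : Summable fun k : ℤ => L k * Real.exp (-(2 * Real.pi * |(k : ℝ)| * (r - r'))))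
include hu hr' hr hc

theorem SphereMultiplier.norm_mul_fourierTerm_le {q : OnePoint ℂ} (hq : q ∈ KM τ M) {p : ℂ × ℂ}
    (hp : p ∈ SD r' ρ) (k : ℤ) : ‖c k q * fourierTerm k (u q) p‖ ≤
      L k * Real.exp (-(2 * Real.pi * |(k : ℝ)| * (r - r'))) * CNorm τ M r ρ u g h := by
  rw [norm_mul, mul_assoc]
  exact mul_le_mul (hc.norm_le ⟨p, hp⟩ k hq) (norm_fourierTerm_le (hr'.trans hr)
    (hu.2.2 q hq).sliceHol (fun p hp => hu.norm_le hq hp) k hp) (norm_nonneg _) (hc.nonneg k)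

include hs

theorem SphereMultiplier.summable_norm {q : OnePoint ℂ} (hq : q ∈ KM τ M) {p : ℂ × ℂ}
    (hp : p ∈ SD r' ρ) : Summable fun k : ℤ => ‖c k q * fourierTerm k (u q) p‖ :=
  .of_nonneg_of_le (fun _ => norm_nonneg _) (hc.norm_mul_fourierTerm_le hu hr' hr hq hp)
    (hs.mul_right _)

theorem SphereMultiplier.fhat_eq
    (hF : ∀ q ∈ KM τ M, ∀ p ∈ SD r' ρ, F q p = ∑' k, c k q * fourierTerm k (u q) p)
    {q : OnePoint ℂ} (hq : q ∈ KM τ M) {ε : ℂ} (hε : ε ∈ ball (0 : ℂ) ρ) (k : ℤ) :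
    fhat F k q ε = c k q * fhat u k q ε := by
  have hstrip : ∀ t : ℝ, ((t : ℂ), ε) ∈ SD r' ρ := fun t => ⟨by simpa [Strip] using hr', hε⟩
  have hsum := hc.summable_norm hu hr' hr hs hq (hstrip 0)
  have e0 : ∀ k, ek k ((0 : ℝ) : ℂ) = 1 := fun k => by simp [ek]
  simp only [fourierTerm, e0, mul_one] at hsum
  rw [show fhat u k q ε = perCoeff (fun θ => u q (θ, ε)) k from rfl, ← perCoeff_tsum hsum k]
  refine intervalIntegral.integral_congr fun t _ => ?_
  simp only [hF q hq _ (hstrip t), fourierTerm, mul_assoc]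

theorem SphereMultiplier.exists_memC
    (hF : ∀ q ∈ KM τ M, ∀ p ∈ SD r' ρ, F q p = ∑' k, c k q * fourierTerm k (u q) p)
    (hper : ∀ q θ ε, F q (θ + 1, ε) = F q (θ, ε)) :
    ∃ g' h' : ℂ → ℂ × ℂ → ℂ, MemC τ M r' ρ F g' h' ∧
      CNorm τ M r' ρ F g' h' ≤ 16 * multiplierSum L (r - r') * CNorm τ M r ρ u g h := by
  have hA := CNorm_nonneg τ M r ρ u g h
  obtain ⟨G₁, hG₁, hS₁⟩ := hu.c1HolBound.exists_sliceHol_deriv hA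
    fun q hq => (hu.2.2 q hq).sliceHol
  obtain ⟨G₂, hG₂, hS₂⟩ := hu.c1HolBound_sphChart.exists_sliceHol_deriv hA
    fun ξ hξ => (hu.2.2 _ (sphChart_mem hξ)).sliceHol
  choose c₁ hc₁ using hc.fin
  choose c₂ hc₂ using hc.inf
  obtain ⟨g', hg'⟩ := hG₁.multiplier (hr'.trans hr) hA
    (fun q hq => (hu.2.2 q hq).sliceHol) hS₁ hc.nonneg hc₁ hs
  obtain ⟨h', hh'⟩ := hG₂.multiplier (hr'.trans hr) hA
    (fun ξ hξ => (hu.2.2 _ (sphChart_mem hξ)).sliceHol) hS₂ hc.nonneg hc₂ hs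
  have hnn : 0 ≤ multiplierSum L (r - r') :=
    tsum_nonneg fun k => mul_nonneg (hc.nonneg k) (Real.exp_pos _).le
  have H := MemC.of_c1HolBound (F := F) (A := 4 * CNorm τ M r ρ u g h * multiplierSum L (r - r'))
    (by positivity) (hg'.congr fun q hq p hp => hF q hq p hp)
    (hh'.congr fun ξ hξ p hp => hF _ (sphChart_mem hξ) p hp) fun q hq => ⟨hper q, ?_⟩
  · refine ⟨g', h', H.1, H.2.trans_eq ?_⟩
    ring
  · refine DifferentiableOn.congr (differentiableOn_tsum_of_norm_le (isOpen_SD r' ρ)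
      (hs.mul_right (CNorm τ M r ρ u g h)) (fun k => ?_)
      fun k p hp => hc.norm_mul_fourierTerm_le hu hr' hr hq hp k) fun p hp => hF q hq p hp
    exact (differentiableOn_fourierTerm (hr'.trans hr) (hu.2.2 q hq).2
      (fun p hp => hu.norm_le hq hp) k).const_mul _

end Multiplier

section Series

variable {τ M r r' ρ : ℝ} {u F F₁ F₂ : OnePoint ℂ → ℂ × ℂ → ℂ} {g h : ℂ → ℂ × ℂ → ℂ}
  {S : Set (ℂ × ℂ)} {c c₁ c₂ : ℤ → OnePoint ℂ → ℂ} {L : ℤ → ℝ}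

theorem SphereMultiplier.deriv (hc : SphereMultiplier τ M S c L) :
    SphereMultiplier τ M S (fun k q => 2 * Real.pi * I * k * c k q)
      (fun k => 2 * Real.pi * |(k : ℝ)| * L k) := by
  have hn : ∀ k : ℤ, ‖(2 * Real.pi * I * k : ℂ)‖ = 2 * Real.pi * |(k : ℝ)| := fun k => by
    simp [abs_of_pos Real.pi_pos]
  refine ⟨fun k => mul_nonneg (by positivity) (hc.nonneg k), fun k => ?_, fun k => ?_⟩
  · obtain ⟨c', h⟩ := hc.fin k
    exact ⟨_, hn k ▸ h.const_mul _⟩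
  · obtain ⟨c', h⟩ := hc.inf k
    exact ⟨_, hn k ▸ h.const_mul _⟩

/-- The coefficients of the Fourier multiplier `Γ`. -/
def gamCoeff (k : ℤ) (q : OnePoint ℂ) : ℂ := if k = 0 then 0 else lamk k q

/-- The coefficients of the Fourier multiplier `Γ⁻`. -/
def gamMCoeff (k : ℤ) (q : OnePoint ℂ) : ℂ := if k = 0 then 0 else -lamk (-k) q

theorem sphereMultiplier_gamCoeff (hτ : 0 < τ) (hM : 1 ≤ M) :
    SphereMultiplier τ M S gamCoeff fun k => 8 * M ^ 2 * |(k : ℝ)| ^ (3 + 2 * τ) := by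
  refine ⟨fun k => by positivity, fun k => ?_, fun k => ?_⟩ <;> by_cases hk : k = 0
  · refine ⟨_, (exists_c1HolBound_lamk (M := M) S hτ hM one_ne_zero).choose_spec |>.const_mul 0
      |>.congr (fun q _ a _ => by simp [gamCoeff, hk]) |>.mono ?_⟩
    rw [norm_zero, zero_mul]; positivity
  · simpa only [gamCoeff, hk, if_false] using exists_c1HolBound_lamk S hτ hM hk
  · refine ⟨_, (exists_c1HolBound_lamk (M := M) S hτ hM one_ne_zero).choose_spec |>.const_mul 0
      |>.congr (fun q _ a _ => by simp [gamCoeff, hk]) |>.mono ?_⟩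
    rw [norm_zero, zero_mul]; positivity
  · have := exists_c1HolBound_lamk S hτ hM (neg_ne_zero.2 hk)
    simpa only [gamCoeff, hk, if_false, lamk_sphChart hk, Int.cast_neg, abs_neg] using this

theorem gamCoeff_sphChart (k : ℤ) (ξ : ℂ) :
    gamCoeff k (sphChart ξ) = -gamMCoeff k (ξ : OnePoint ℂ) := by
  by_cases hk : k = 0
  · simp [gamCoeff, gamMCoeff, hk]
  · simp [gamCoeff, gamMCoeff, hk, lamk_sphChart hk]

theorem gamMCoeff_sphChart (k : ℤ) (ξ : ℂ) :
    gamMCoeff k (sphChart ξ) = -gamCoeff k (ξ : OnePoint ℂ) := by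
  by_cases hk : k = 0
  · simp [gamCoeff, gamMCoeff, hk]
  · simp [gamCoeff, gamMCoeff, hk, lamk_sphChart (neg_ne_zero.2 hk)]

theorem sphereMultiplier_gamMCoeff (hτ : 0 < τ) (hM : 1 ≤ M) :
    SphereMultiplier τ M S gamMCoeff fun k => 8 * M ^ 2 * |(k : ℝ)| ^ (3 + 2 * τ) := by
  have H := sphereMultiplier_gamCoeff (S := S) hτ hM
  refine ⟨H.nonneg, fun k => ?_, fun k => ?_⟩
  · obtain ⟨c', h⟩ := H.inf k
    have h := (h.const_mul (-1)).congr (v := fun q _ => gamMCoeff k (q : OnePoint ℂ))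
      fun q _ _ _ => by rw [gamCoeff_sphChart]; ring
    rw [norm_neg, norm_one, one_mul] at h
    exact ⟨_, h⟩
  · obtain ⟨c', h⟩ := H.fin k
    have h := (h.const_mul (-1)).congr (v := fun ξ _ => gamMCoeff k (sphChart ξ))
      fun q _ _ _ => by rw [gamMCoeff_sphChart]; ring
    rw [norm_neg, norm_one, one_mul] at h
    exact ⟨_, h⟩

theorem gamMCoeff_sub_gamCoeff (hτ : 0 < τ) (hM : 1 ≤ M) (k : ℤ) {q : OnePoint ℂ}
    (hq : q ∈ KM τ M) : gamMCoeff k q - gamCoeff k q = if k = 0 then 0 else 1 := by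
  have H : ∀ z ∈ finPart (KM τ M), gamMCoeff k (z : OnePoint ℂ) - gamCoeff k (z : OnePoint ℂ) =
      if k = 0 then 0 else 1 := by
    intro z hz
    by_cases hk : k = 0
    · simp [gamCoeff, gamMCoeff, hk]
    · simp only [gamCoeff, gamMCoeff, hk, if_false]
      rw [lamk_neg_add hk (pow_ne_one_of_mem hτ hM hk hz)]
      ring
  induction q using OnePoint.rec with
  | infty =>
    rw [← H 0 zero_mem_finPart_KM, ← sphChart_zero, gamCoeff_sphChart, gamMCoeff_sphChart]
    ring
  | coe z => exact H z hq

theorem zpow_mul_gamCoeff (hτ : 0 < τ) (hM : 1 ≤ M) (k : ℤ) {q : ℂ} (hq : (q : OnePoint ℂ) ∈ KM τ M)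
    (hq0 : q ≠ 0) : q ^ k * gamCoeff k q = gamMCoeff k q := by
  by_cases hk : k = 0
  · simp [gamCoeff, gamMCoeff, hk]
  · have h := gamMCoeff_sub_gamCoeff hτ hM k hq
    have h1 : q ^ k - 1 ≠ 0 :=
      sub_ne_zero.2 ((pow_ne_one_of_mem hτ hM hk hq).resolve_left hq0)
    rw [if_neg hk, sub_eq_iff_eq_add] at h
    rw [h, gamCoeff, if_neg hk, lamk_coe hq0]
    field_simp
    ring

theorem GamFn_term_eq (u : OnePoint ℂ → ℂ × ℂ → ℂ) (q : OnePoint ℂ) (p : ℂ × ℂ) (k : ℤ) :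
    (if k = 0 then 0 else lamk k q * fhat u k q p.2 * ek k p.1) =
      gamCoeff k q * fourierTerm k (u q) p := by
  rw [gamCoeff]
  split_ifs
  · rw [zero_mul]
  · rw [mul_assoc]; rfl

theorem GamMFn_term_eq (u : OnePoint ℂ → ℂ × ℂ → ℂ) (q : OnePoint ℂ) (p : ℂ × ℂ) (k : ℤ) :
    (if k = 0 then 0 else -(lamk (-k) q) * fhat u k q p.2 * ek k p.1) =
      gamMCoeff k q * fourierTerm k (u q) p := by
  rw [gamMCoeff]
  split_ifs
  · rw [zero_mul]
  · rw [mul_assoc]; rfl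

/-- `Σ_k c_k(q) φ̂_k(q) e_k`. -/
def multiplierSeries (c : ℤ → OnePoint ℂ → ℂ) (u : OnePoint ℂ → ℂ × ℂ → ℂ) (q : OnePoint ℂ)
    (p : ℂ × ℂ) : ℂ :=
  ∑' k, c k q * fourierTerm k (u q) p

theorem GamFn_eq (u : OnePoint ℂ → ℂ × ℂ → ℂ) : GamFn u = multiplierSeries gamCoeff u := by
  ext q p
  exact tsum_congr (GamFn_term_eq u q p)

theorem GamMFn_eq (u : OnePoint ℂ → ℂ × ℂ → ℂ) : GamMFn u = multiplierSeries gamMCoeff u := by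
  ext q p
  exact tsum_congr (GamMFn_term_eq u q p)

theorem multiplierSeries_add_one (c : ℤ → OnePoint ℂ → ℂ) (u : OnePoint ℂ → ℂ × ℂ → ℂ)
    (q : OnePoint ℂ) (θ ε : ℂ) :
    multiplierSeries c u q (θ + 1, ε) = multiplierSeries c u q (θ, ε) := by
  simp only [multiplierSeries, fourierTerm_add_one]

theorem dth_add_one (hper : ∀ q θ ε, F q (θ + 1, ε) = F q (θ, ε)) (q : OnePoint ℂ) (θ ε : ℂ) :
    dth F q (θ + 1, ε) = dth F q (θ, ε) := by
  simp only [dth]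
  rw [← deriv_comp_add_const]
  simp only [hper]

variable (hu : MemC τ M r ρ u g h) (hr' : 0 < r') (hr : r' < r)
include hu hr' hr

theorem dth_multiplierSeries (hc : SphereMultiplier τ M (SD r' ρ) c L)
    (hs : Summable fun k : ℤ => L k * Real.exp (-(2 * Real.pi * |(k : ℝ)| * (r - r'))))
    {q : OnePoint ℂ} (hq : q ∈ KM τ M) {p : ℂ × ℂ} (hp : p ∈ SD r' ρ) :
    dth (multiplierSeries c u) q p =
      multiplierSeries (fun k q => 2 * Real.pi * I * k * c k q) u q p := by
  have hd : ∀ (k : ℤ) (θ : ℂ), HasDerivAt (fun t => c k q * fourierTerm k (u q) (t, p.2))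
      (2 * Real.pi * I * k * c k q * fourierTerm k (u q) (θ, p.2)) θ := by
    intro k θ
    have := (((differentiable_ek k θ).hasDerivAt.const_mul
      (perCoeff (fun θ => u q (θ, p.2)) k)).const_mul (c k q))
    rw [deriv_ek] at this
    refine this.congr_deriv ?_
    simp only [fourierTerm]
    ring
  have := hasSum_deriv_of_summable_norm (hs.mul_right (CNorm τ M r ρ u g h))
    (F := fun k t => c k q * fourierTerm k (u q) (t, p.2)) (fun k θ _ =>
      (hd k θ).differentiableAt.differentiableWithinAt) (isOpen_Strip r') (fun k θ hθ =>
      hc.norm_mul_fourierTerm_le hu hr' hr hq (p := (θ, p.2)) ⟨hθ, hp.2⟩ k) hp.1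
  simp only [(hd _ _).deriv] at this
  exact this.tsum_eq.symm

/-- The two series attached to multipliers with `c₂ = q^k c₁` are related by `φ ↦ φ⁺`, `φ ↦ φ⁻`. -/
theorem exists_memC_pair (hc₁ : SphereMultiplier τ M (SD r' ρ) c₁ L)
    (hc₂ : SphereMultiplier τ M (SD r' ρ) c₂ L)
    (hs : Summable fun k : ℤ => L k * Real.exp (-(2 * Real.pi * |(k : ℝ)| * (r - r'))))
    (hF₁ : ∀ q ∈ KM τ M, ∀ p ∈ SD r' ρ, F₁ q p = multiplierSeries c₁ u q p)
    (hF₂ : ∀ q ∈ KM τ M, ∀ p ∈ SD r' ρ, F₂ q p = multiplierSeries c₂ u q p)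
    (hper₁ : ∀ q θ ε, F₁ q (θ + 1, ε) = F₁ q (θ, ε))
    (hper₂ : ∀ q θ ε, F₂ q (θ + 1, ε) = F₂ q (θ, ε))
    (hrel : ∀ k : ℤ, ∀ q : ℂ, (q : OnePoint ℂ) ∈ KM τ M → q ≠ 0 → q ^ k * c₁ k q = c₂ k q) :
    ∃ g₁ h₁ g₂ h₂ : ℂ → ℂ × ℂ → ℂ, MemC τ M r' ρ F₁ g₁ h₁ ∧ MemC τ M r' ρ F₂ g₂ h₂ ∧
      IsPlus τ M r' ρ F₁ F₂ ∧ IsMinus τ M r' ρ F₂ F₁ ∧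
      max (CNorm τ M r' ρ F₁ g₁ h₁) (CNorm τ M r' ρ F₂ g₂ h₂) ≤
        16 * multiplierSum L (r - r') * CNorm τ M r ρ u g h := by
  obtain ⟨g₁, h₁, hm₁, hb₁⟩ := hc₁.exists_memC hu hr' hr hs hF₁ hper₁
  obtain ⟨g₂, h₂, hm₂, hb₂⟩ := hc₂.exists_memC hu hr' hr hs hF₂ hper₂
  refine ⟨g₁, h₁, g₂, h₂, hm₁, hm₂, fun q hq hq0 θ hθ ε hε => ?_, fun q hq hq0 θ hθ ε hε => ?_,
    max_le hb₁ hb₂⟩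
  · rw [hF₂ q hq (θ, ε) ⟨hθ, hε⟩]
    refine (hc₂.summable_norm hu hr' hr hs hq ⟨hθ, hε⟩).of_norm.hasSum.congr_fun fun k => ?_
    rw [hc₁.fhat_eq hu hr' hr hs hF₁ hq hε, ← mul_assoc, hrel k q hq hq0, mul_assoc]
    rfl
  · rw [hF₁ q hq (θ, ε) ⟨hθ, hε⟩]
    refine (hc₁.summable_norm hu hr' hr hs hq ⟨hθ, hε⟩).of_norm.hasSum.congr_fun fun k => ?_
    rw [hc₂.fhat_eq hu hr' hr hs hF₂ hq hε, ← mul_assoc, ← hrel k q hq hq0, ← mul_assoc,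
      ← zpow_add₀ hq0, neg_add_cancel, zpow_zero, one_mul, mul_assoc]
    rfl

omit hr' in
theorem GamMFn_sub_GamFn (hτ : 0 < τ) (hM : 1 ≤ M)
    {q : OnePoint ℂ} (hq : q ∈ KM τ M) {p : ℂ × ℂ} (hp : p ∈ SD r' ρ)
    (h₁ : Summable fun k => gamCoeff k q * fourierTerm k (u q) p)
    (h₂ : Summable fun k => gamMCoeff k q * fourierTerm k (u q) p) :
    GamMFn u q p - GamFn u q p = u q p - fhat u 0 q p.2 := by
  have hs : HasSum (fun k => fourierTerm k (u q) p) (u q p) :=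
    ((hu.2.2 q hq).sliceHol p.2 hp.2).hasSum (fun θ hθ => hu.norm_le hq ⟨hθ, hp.2⟩)
      (Strip_mono hr.le hp.1)
  have h0 : HasSum (fun k : ℤ => if k = 0 then fhat u 0 q p.2 else 0) (fhat u 0 q p.2) :=
    hasSum_ite_eq 0 _
  rw [GamFn_eq, GamMFn_eq]
  refine ((h₂.hasSum.sub h₁.hasSum).congr_fun fun k => ?_).unique (hs.sub h0)
  rw [← sub_mul, gamMCoeff_sub_gamCoeff hτ hM k hq]
  split_ifs with hk
  · subst hk
    simp [fourierTerm, ek, fhat, perCoeff]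
  · ring

end Series

end MultiplierEstimates

/-- Small divisor estimates for the solution of the
cohomological equation: for `0 < r' < r` and `φ ∈ C_r` (data `(u,g,h)`), the
formulas for `Γφ` and `Γ⁻φ` define elements of `C⁺_{r'}` and `C⁻_{r'}` with
`∇(Γφ) = ∇⁻(Γ⁻φ) = φ − φ̂₀`, `(Γφ)⁺ = Γ⁻φ`, `(Γ⁻φ)⁻ = Γφ`, and — for a constant
`C₁ > 0` depending only on `τ`, provided `r − r' ≤ 1` — the norm estimates
`‖Γφ‖⁺_{r'}, ‖Γ⁻φ‖⁻_{r'} ≤ C₁M²(r−r')^{−σ}‖φ‖_r` and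
`‖∂_θΓφ‖⁺_{r'}, ‖∂_θΓ⁻φ‖⁻_{r'} ≤ C₁M²(r−r')^{−σ−1}‖φ‖_r`, where `σ = 4+2τ`. -/
theorem gamma_solves_cohomological_equation (τ : ℝ) (hτ : 0 < τ) :
    ∃ C₁ : ℝ, 0 < C₁ ∧
      ∀ M ρ r r' : ℝ, 2 * zetaR (1 + τ) < M → 0 < ρ → 0 < r' → r' < r →
        ∀ u : OnePoint ℂ → ℂ × ℂ → ℂ, ∀ g h : ℂ → ℂ × ℂ → ℂ,
          MemC τ M r ρ u g h →
          -- the defining series converge: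
          (∀ q ∈ KM τ M, ∀ pt ∈ SD r' ρ,
            Summable (fun k : ℤ =>
              if k = 0 then 0 else lamk k q * fhat u k q pt.2 * ek k pt.1) ∧
            Summable (fun k : ℤ =>
              if k = 0 then 0 else -(lamk (-k) q) * fhat u k q pt.2 * ek k pt.1)) ∧
          ∃ g1 h1 g2 h2 : ℂ → ℂ × ℂ → ℂ,
            -- `Γφ, Γ⁻φ ∈ C_{r'}`:
            MemC τ M r' ρ (GamFn u) g1 h1 ∧
            MemC τ M r' ρ (GamMFn u) g2 h2 ∧
            -- `(Γφ)⁺ = Γ⁻φ` (hence `Γφ ∈ C⁺_{r'}`) and `(Γ⁻φ)⁻ = Γφ` (hence `Γ⁻φ ∈ C⁻_{r'}`):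
            IsPlus τ M r' ρ (GamFn u) (GamMFn u) ∧
            IsMinus τ M r' ρ (GamMFn u) (GamFn u) ∧
            -- `∇(Γφ) = ∇⁻(Γ⁻φ) = φ − φ̂₀` in `C_{r'}`:
            (∀ q ∈ KM τ M, ∀ pt ∈ SD r' ρ,
              GamMFn u q pt - GamFn u q pt = u q pt - fhat u 0 q pt.2) ∧
            -- norm estimates `‖Γφ‖⁺_{r'} = ‖Γ⁻φ‖⁻_{r'} = max(‖Γφ‖_{r'},‖Γ⁻φ‖_{r'})`:
            (r - r' ≤ 1 →
              max (CNorm τ M r' ρ (GamFn u) g1 h1) (CNorm τ M r' ρ (GamMFn u) g2 h2) ≤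
                C₁ * M ^ 2 / (r - r') ^ (4 + 2 * τ) * CNorm τ M r ρ u g h) ∧
            ∃ g3 h3 g4 h4 : ℂ → ℂ × ℂ → ℂ,
              MemC τ M r' ρ (dth (GamFn u)) g3 h3 ∧
              MemC τ M r' ρ (dth (GamMFn u)) g4 h4 ∧
              IsPlus τ M r' ρ (dth (GamFn u)) (dth (GamMFn u)) ∧
              IsMinus τ M r' ρ (dth (GamMFn u)) (dth (GamFn u)) ∧
              (r - r' ≤ 1 →
                max (CNorm τ M r' ρ (dth (GamFn u)) g3 h3)
                    (CNorm τ M r' ρ (dth (GamMFn u)) g4 h4) ≤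
                  C₁ * M ^ 2 / (r - r') ^ (4 + 2 * τ + 1) * CNorm τ M r ρ u g h) := by
  obtain ⟨Ca, hCa, Ha⟩ := exists_tsum_rpow_mul_exp_le (s := 3 + 2 * τ) (by positivity)
  obtain ⟨Cb, hCb, Hb⟩ := exists_tsum_rpow_mul_exp_le (s := 4 + 2 * τ) (by positivity)
  refine ⟨128 * Ca + 256 * Real.pi * Cb, by positivity, fun M ρ r r' hM _ hr' hr u g h hu => ?_⟩
  have hM1 : 1 ≤ M := by linarith [one_le_zetaR (s := 1 + τ) (by linarith)]
  have hd : 0 < r - r' := sub_pos.2 hr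
  have hN := CNorm_nonneg τ M r ρ u g h
  set La : ℤ → ℝ := fun k => 8 * M ^ 2 * |(k : ℝ)| ^ (3 + 2 * τ) with hLa
  have hG := sphereMultiplier_gamCoeff (S := SD r' ρ) hτ hM1
  have hGM := sphereMultiplier_gamMCoeff (S := SD r' ρ) hτ hM1
  have ea : (fun k : ℤ => La k * Real.exp (-(2 * Real.pi * |(k : ℝ)| * (r - r')))) = fun k : ℤ =>
      8 * M ^ 2 * (|(k : ℝ)| ^ (3 + 2 * τ) * Real.exp (-(2 * Real.pi * |(k : ℝ)| * (r - r')))) := by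
    ext k; rw [hLa]; ring
  have eb : (fun k : ℤ => 2 * Real.pi * |(k : ℝ)| * La k *
      Real.exp (-(2 * Real.pi * |(k : ℝ)| * (r - r')))) = fun k : ℤ => 16 * Real.pi * M ^ 2 *
        (|(k : ℝ)| ^ (4 + 2 * τ) * Real.exp (-(2 * Real.pi * |(k : ℝ)| * (r - r')))) := by
    ext k
    have : |(k : ℝ)| ^ (4 + 2 * τ) = |(k : ℝ)| ^ (3 + 2 * τ) * |(k : ℝ)| := by
      rw [← Real.rpow_add_one' (abs_nonneg _) (by positivity)]
      ring_nf
    rw [hLa, this]; ring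
  have hsa : Summable fun k : ℤ => La k * Real.exp (-(2 * Real.pi * |(k : ℝ)| * (r - r'))) :=
    ea ▸ (Ha _ hd).1.mul_left _
  have hsb : Summable fun k : ℤ => 2 * Real.pi * |(k : ℝ)| * La k *
      Real.exp (-(2 * Real.pi * |(k : ℝ)| * (r - r'))) := eb ▸ (Hb _ hd).1.mul_left _
  have hsG := fun q (hq : q ∈ KM τ M) p (hp : p ∈ SD r' ρ) =>
    (hG.summable_norm hu hr' hr hsa hq hp).of_norm
  have hsGM := fun q (hq : q ∈ KM τ M) p (hp : p ∈ SD r' ρ) =>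
    (hGM.summable_norm hu hr' hr hsa hq hp).of_norm
  refine ⟨fun q hq p hp => ⟨(hsG q hq p hp).congr fun k => (GamFn_term_eq u q p k).symm,
    (hsGM q hq p hp).congr fun k => (GamMFn_term_eq u q p k).symm⟩, ?_⟩
  have hperG := multiplierSeries_add_one gamCoeff u
  have hperGM := multiplierSeries_add_one gamMCoeff u
  obtain ⟨g₁, h₁, g₂, h₂, m₁, m₂, hp, hm, hb⟩ := exists_memC_pair hu hr' hr hG hGM hsa
    (F₁ := GamFn u) (F₂ := GamMFn u) (fun q _ p _ => by rw [GamFn_eq])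
    (fun q _ p _ => by rw [GamMFn_eq]) (by rwa [GamFn_eq]) (by rwa [GamMFn_eq])
    fun k q hq hq0 => zpow_mul_gamCoeff hτ hM1 k hq hq0
  obtain ⟨g₃, h₃, g₄, h₄, m₃, m₄, hp', hm', hb'⟩ := exists_memC_pair hu hr' hr hG.deriv hGM.deriv
    hsb (F₁ := dth (GamFn u)) (F₂ := dth (GamMFn u))
    (fun q hq p hp => by rw [GamFn_eq, dth_multiplierSeries hu hr' hr hG hsa hq hp])
    (fun q hq p hp => by rw [GamMFn_eq, dth_multiplierSeries hu hr' hr hGM hsa hq hp])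
    (dth_add_one (by rwa [GamFn_eq])) (dth_add_one (by rwa [GamMFn_eq]))
    fun k q hq hq0 => by rw [← zpow_mul_gamCoeff hτ hM1 k hq hq0]; ring
  refine ⟨g₁, h₁, g₂, h₂, m₁, m₂, hp, hm, fun q hq p hp => GamMFn_sub_GamFn hu hr hτ hM1 hq hp
    (hsG q hq p hp) (hsGM q hq p hp), fun h1 => hb.trans ?_,
    g₃, h₃, g₄, h₄, m₃, m₄, hp', hm', fun h1 => hb'.trans ?_⟩
  · have hS : multiplierSum La (r - r') ≤ 8 * M ^ 2 * (Ca / (r - r') ^ (4 + 2 * τ)) := by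
      rw [multiplierSum, ea, tsum_mul_left, show 4 + 2 * τ = 3 + 2 * τ + 1 by ring]
      gcongr
      exact (Ha _ hd).2 h1
    gcongr
    calc _ ≤ 16 * (8 * M ^ 2 * (Ca / (r - r') ^ (4 + 2 * τ))) := by gcongr
      _ = 128 * Ca * M ^ 2 / (r - r') ^ (4 + 2 * τ) := by ring
      _ ≤ _ := by
        gcongr
        have := Real.pi_pos
        exact le_add_of_nonneg_right (by positivity)
  · have hS : multiplierSum (fun k : ℤ => 2 * Real.pi * |(k : ℝ)| * La k) (r - r') ≤
        16 * Real.pi * M ^ 2 * (Cb / (r - r') ^ (4 + 2 * τ + 1)) := by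
      rw [multiplierSum, eb, tsum_mul_left]
      have := Real.pi_pos
      gcongr
      exact (Hb _ hd).2 h1
    gcongr
    calc _ ≤ 16 * (16 * Real.pi * M ^ 2 * (Cb / (r - r') ^ (4 + 2 * τ + 1))) := by gcongr
      _ = 256 * Real.pi * Cb * M ^ 2 / (r - r') ^ (4 + 2 * τ + 1) := by ring
      _ ≤ _ := by
        gcongr
        exact le_add_of_nonneg_left (by positivity)
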